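/- arXiv:2007.16081 — 3 statements merged into one kernel-verified Lean document; each statement's English description precedes it below -/
import Mathlib

section
/- Let G be a finite Frobenius group with abelian kernel F and complement of order 2. Then van(G) = G − F and pv(G) = 1/2. -/
open CategoryTheory

/-- An element `g` of a group is a *vanishing element* if some irreducible complex
character vanishes at `g`. -/
def IsVanishing {G : Type} [Group G] (g : G) : Prop :=
  ∃ V : FDRep ℂ G, Simple V ∧ V.character g = 0

/-- The proportion of vanishing elements of `G`. -/
noncomputable def pv (G : Type) [Group G] : ℝ :=
  (Set.ncard {g : G | IsVanishing g}) / (Nat.card G)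

/-- The proportion of non-vanishing elements of `G`. -/
noncomputable def pnv (G : Type) [Group G] : ℝ :=
  (Set.ncard {g : G | ¬ IsVanishing g}) / (Nat.card G)


/-- `G` is a Frobenius group with kernel `F`: `F` is a nontrivial proper normal subgroup
and the centralizer of every nonidentity element of `F` is contained in `F`. -/
def IsFrobeniusWithKernel (G : Type) [Group G] (F : Subgroup G) : Prop :=
  F.Normal ∧ F ≠ ⊥ ∧ F ≠ ⊤ ∧
    ∀ x ∈ F, x ≠ 1 → ∀ g : G, g * x = x * g → g ∈ F

namespace IsFrobeniusWithKernel

variable {G : Type} [Group G] {F : Subgroup G}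

lemma mul_self_eq_one (hF : IsFrobeniusWithKernel G F) (h2 : F.index = 2) {h : G}
    (hh : h ∉ F) : h * h = 1 := by
  by_contra hne
  exact hh (hF.2.2.2 (h * h) (Subgroup.mul_self_mem_of_index_two h2 h) hne h (by group))

lemma conj_eq_inv (hF : IsFrobeniusWithKernel G F) (h2 : F.index = 2) {h x : G}
    (hh : h ∉ F) (hx : x ∈ F) : h * x * h = x⁻¹ := by
  have hhx : h * x ∉ F := fun H => hh ((Subgroup.mul_mem_cancel_right F hx).1 H)
  exact eq_inv_of_mul_eq_one_left (by simpa [mul_assoc] using hF.mul_self_eq_one h2 hhx)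

lemma eq_one_of_mul_self_eq_one (hF : IsFrobeniusWithKernel G F) (h2 : F.index = 2) {x : G}
    (hx : x ∈ F) (hxx : x * x = 1) : x = 1 := by
  obtain ⟨h, hh⟩ : ∃ h, h ∉ F := by
    by_contra! H
    exact hF.2.2.1 ((Subgroup.eq_top_iff' F).2 H)
  by_contra hne
  refine hh (hF.2.2.2 x hx hne h ?_)
  have hc := hF.conj_eq_inv h2 hh hx
  rw [← eq_inv_of_mul_eq_one_left hxx] at hc
  calc h * x = h * x * (h * h) := by rw [hF.mul_self_eq_one h2 hh, mul_one]
    _ = h * x * h * h := by group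
    _ = x * h := by rw [hc]

lemma odd_orderOf [Finite G] (hF : IsFrobeniusWithKernel G F) (h2 : F.index = 2) {x : G}
    (hx : x ∈ F) : Odd (orderOf x) := by
  by_contra hodd
  obtain ⟨m, hm⟩ := Nat.not_odd_iff_even.1 hodd
  have hpos := orderOf_pos x
  have h1 : x ^ m = 1 := hF.eq_one_of_mul_self_eq_one h2 (F.pow_mem hx m)
    (by rw [← pow_add, ← hm, pow_orderOf_eq_one])
  have := Nat.le_of_dvd (by omega) (orderOf_dvd_of_pow_eq_one h1)
  omega

end IsFrobeniusWithKernel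

/-- Schur's lemma for finite-dimensional complex representations. -/
lemma FDRep.exists_eq_smul_id_of_commute {G : Type} [Group G] (V : FDRep ℂ G) [Simple V]
    (T : V →ₗ[ℂ] V) (hT : ∀ g, T ∘ₗ V.ρ g = V.ρ g ∘ₗ T) :
    ∃ c : ℂ, T = c • LinearMap.id := by
  let f : V ⟶ V := ⟨InducedCategory.homMk (ModuleCat.ofHom T), fun g => by
    ext1
    exact hT g⟩
  obtain ⟨c, hc⟩ := endomorphism_simple_eq_smul_id ℂ f
  refine ⟨c, ?_⟩
  have := congrArg (fun k : V ⟶ V => k.hom.hom.hom) hc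
  exact this.symm

/-- A simple representation has nonzero dimension. -/
lemma FDRep.finrank_ne_zero_of_simple {G : Type} [Group G] (V : FDRep ℂ G) [Simple V] :
    Module.finrank ℂ V ≠ 0 := by
  intro h0
  have : Subsingleton V := Module.finrank_zero_iff.1 h0
  refine id_nonzero V ?_
  apply Action.Hom.ext
  ext v
  exact Subsingleton.elim (α := V) _ _

lemma FDRep.character_ne_zero_of_mem_kernel {G : Type} [Group G] [Finite G] {F : Subgroup G}
    (hF : IsFrobeniusWithKernel G F) (hab : ∀ x y : F, x * y = y * x) (h2 : F.index = 2)
    (V : FDRep ℂ G) [Simple V] {x : G} (hx : x ∈ F) : V.character x ≠ 0 := by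
  intro h0
  have hconj {g : G} (hg : g ∉ F) {y : G} (hy : y ∈ F) : y * g = g * y⁻¹ := by
    have hgg := hF.mul_self_eq_one h2 hg
    rw [← hF.conj_eq_inv h2 hg hy, ← mul_assoc, ← mul_assoc, hgg, one_mul]
  have hcomm {g : G} (hg : g ∈ F) {y : G} (hy : y ∈ F) : y * g = g * y :=
    congrArg Subtype.val (hab ⟨y, hy⟩ ⟨g, hg⟩)
  obtain ⟨c, hc⟩ := V.exists_eq_smul_id_of_commute (V.ρ x + V.ρ x⁻¹) (fun g => by
    change (V.ρ x + V.ρ x⁻¹) * V.ρ g = V.ρ g * (V.ρ x + V.ρ x⁻¹)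
    rw [add_mul, mul_add, ← map_mul, ← map_mul, ← map_mul, ← map_mul]
    by_cases hg : g ∈ F
    · rw [hcomm hg hx, hcomm hg (F.inv_mem hx)]
    · rw [hconj hg hx, hconj hg (F.inv_mem hx), inv_inv, add_comm])
  obtain ⟨h, hh⟩ : ∃ h, h ∉ F := by
    by_contra! H
    exact hF.2.2.1 ((Subgroup.eq_top_iff' F).2 H)
  have hinv : V.character x⁻¹ = V.character x := by
    rw [← V.char_conj x h, ← hF.conj_eq_inv h2 hh hx,
      inv_eq_of_mul_eq_one_left (hF.mul_self_eq_one h2 hh)]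
  have htr : V.character x + V.character x⁻¹ = c * Module.finrank ℂ V := by
    have := congrArg (LinearMap.trace ℂ V) hc
    rwa [map_add, map_smul, LinearMap.trace_id, smul_eq_mul] at this
  rw [hinv, h0, add_zero, eq_comm, mul_eq_zero, Nat.cast_eq_zero] at htr
  have hc0 : c = 0 := htr.resolve_right V.finrank_ne_zero_of_simple
  rw [hc0, zero_smul] at hc
  have hsq : V.ρ x * V.ρ x = -1 := by
    have hsum := congrArg (fun T : Module.End ℂ V => V.ρ x * T) hc
    simp only [mul_add, ← map_mul, mul_inv_cancel, map_one] at hsum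
    rw [← map_mul]
    exact eq_neg_of_add_eq_zero_left (hsum.trans (mul_zero _))
  have hpow : (1 : Module.End ℂ V) = -1 := by
    calc (1 : Module.End ℂ V) = (V.ρ x * V.ρ x) ^ orderOf x := by
          rw [← map_mul, ← map_pow, ← pow_two, ← pow_mul, mul_comm, pow_mul,
            pow_orderOf_eq_one, one_pow, map_one]
      _ = -1 := by rw [hsq, (hF.odd_orderOf h2 hx).neg_one_pow]
  have htr1 := congrArg (LinearMap.trace ℂ V) hpow
  rw [map_neg, LinearMap.trace_one, self_eq_neg, Nat.cast_eq_zero] at htr1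
  exact V.finrank_ne_zero_of_simple htr1

/-- A nontrivial finite abelian group has a nontrivial complex linear character. -/
lemma exists_monoidHom_complex_ne_one (A : Type) [CommGroup A] [Finite A] [Nontrivial A] :
    ∃ l : A →* ℂ, l ≠ 1 := by
  obtain ⟨a, ha⟩ := exists_ne (1 : A)
  obtain ⟨φ, hφ⟩ := CommGroup.exists_apply_ne_one_of_hasEnoughRootsOfUnity A ℂ ha
  refine ⟨(Units.coeHom ℂ).comp φ, fun H => hφ ?_⟩
  exact Units.ext (DFunLike.congr_fun H a)

open Classical in
/-- The extension by zero of a function on a subgroup. -/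
noncomputable def Subgroup.extendByZero {G : Type} [Group G] (F : Subgroup G) (l : F → ℂ) (g : G) :
    ℂ :=
  if hg : g ∈ F then l ⟨g, hg⟩ else 0

section Induced

variable {G : Type} [Group G] {F : Subgroup G}

lemma Subgroup.extendByZero_of_mem (l : F → ℂ) {g : G} (hg : g ∈ F) :
    F.extendByZero l g = l ⟨g, hg⟩ := dif_pos hg

lemma Subgroup.extendByZero_of_notMem (l : F → ℂ) {g : G} (hg : g ∉ F) :
    F.extendByZero l g = 0 := dif_neg hg

lemma Subgroup.extendByZero_mul (l : F →* ℂ) {a b : G} (ha : a ∈ F) (hb : b ∈ F) :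
    F.extendByZero l (a * b) = F.extendByZero l a * F.extendByZero l b := by
  rw [extendByZero_of_mem _ ha, extendByZero_of_mem _ hb, extendByZero_of_mem _ (F.mul_mem ha hb),
    ← map_mul]
  rfl

/-- The matrix representation induced from a linear character of a subgroup of index two, with
respect to the transversal formed by `1` and an involution `h`. -/
noncomputable def inducedMatrix (h2 : F.index = 2) {h : G} (hh : h ∉ F) (hhh : h * h = 1)
    (l : F →* ℂ) : G →* Matrix (Fin 2) (Fin 2) ℂ where
  toFun g := !![F.extendByZero l g, F.extendByZero l (g * h);
    F.extendByZero l (h * g), F.extendByZero l (h * g * h)]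
  map_one' := by
    rw [one_mul, mul_one, hhh, Subgroup.extendByZero_of_notMem _ hh,
      Subgroup.extendByZero_of_mem _ F.one_mem, Matrix.one_fin_two]
    have : l ⟨1, F.one_mem⟩ = 1 := map_one l
    rw [this]
  map_mul' a b := by
    have hm (a b : G) := Subgroup.mul_mem_iff_of_index_two h2 (a := a) (b := b)
    have hz {g : G} (hg : g ∉ F) := Subgroup.extendByZero_of_notMem (⇑l) hg
    have key (a b : G) : F.extendByZero l (a * b) = F.extendByZero l a * F.extendByZero l b +
        F.extendByZero l (a * h) * F.extendByZero l (h * b) := by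
      by_cases ha : a ∈ F <;> by_cases hb : b ∈ F
      · rw [hz (g := a * h) (by simp [hm, ha, hh]), zero_mul, add_zero,
          Subgroup.extendByZero_mul l ha hb]
      · rw [hz (g := a * h) (by simp [hm, ha, hh]), hz hb, hz (by simp [hm, ha, hb])]
        simp
      · rw [hz ha, hz (g := h * b) (by simp [hm, hb, hh]), hz (by simp [hm, ha, hb])]
        simp
      · rw [hz ha, zero_mul, zero_add, ← Subgroup.extendByZero_mul l (by simp [hm, ha, hh])
          (by simp [hm, hb, hh]), mul_assoc a, ← mul_assoc h, hhh, one_mul]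
    rw [Matrix.mul_fin_two]
    congr 1
    rw [key a b, mul_assoc a b h, key a (b * h), ← mul_assoc h a b, key (h * a) b,
      mul_assoc (h * a) b h, key (h * a) (b * h)]
    simp only [mul_assoc]

/-- The two-dimensional representation induced from a linear character of a subgroup of index
two. -/
noncomputable def inducedFDRep (h2 : F.index = 2) {h : G} (hh : h ∉ F) (hhh : h * h = 1)
    (l : F →* ℂ) : FDRep ℂ G :=
  FDRep.of (V := Fin 2 → ℂ)
    ((Matrix.toLinAlgEquiv' (R := ℂ) (n := Fin 2) :
      Matrix (Fin 2) (Fin 2) ℂ →* ((Fin 2 → ℂ) →ₗ[ℂ] (Fin 2 → ℂ))).comp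
      (inducedMatrix h2 hh hhh l))

lemma inducedFDRep_character (h2 : F.index = 2) {h : G} (hh : h ∉ F) (hhh : h * h = 1)
    (l : F →* ℂ) (g : G) : (inducedFDRep h2 hh hhh l).character g =
      F.extendByZero l g + F.extendByZero l (h * g * h) := by
  change LinearMap.trace ℂ (Fin 2 → ℂ) (Matrix.toLin' (inducedMatrix h2 hh hhh l g)) = _
  rw [Matrix.trace_toLin'_eq]
  exact Matrix.trace_fin_two_of _ _ _ _

lemma inducedFDRep_character_of_notMem (h2 : F.index = 2) {h : G} (hh : h ∉ F) (hhh : h * h = 1)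
    (l : F →* ℂ) {g : G} (hg : g ∉ F) : (inducedFDRep h2 hh hhh l).character g = 0 := by
  rw [inducedFDRep_character, Subgroup.extendByZero_of_notMem _ hg,
    Subgroup.extendByZero_of_notMem, add_zero]
  simp [Subgroup.mul_mem_iff_of_index_two h2, hh, hg]

lemma IsFrobeniusWithKernel.inducedFDRep_character_coe (hF : IsFrobeniusWithKernel G F)
    (h2 : F.index = 2) {h : G} (hh : h ∉ F) (hhh : h * h = 1) (l : F →* ℂ) (x : F) :
    (inducedFDRep h2 hh hhh l).character x = l x + l x⁻¹ := by
  rw [inducedFDRep_character, hF.conj_eq_inv h2 hh x.2, Subgroup.extendByZero_of_mem _ x.2,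
    Subgroup.extendByZero_of_mem _ (F.inv_mem x.2)]
  rfl

lemma IsFrobeniusWithKernel.simple_inducedFDRep [Finite G] (hF : IsFrobeniusWithKernel G F)
    (h2 : F.index = 2) {h : G} (hh : h ∉ F) (hhh : h * h = 1) {l : F →* ℂ} (hl : l ≠ 1) :
    Simple (inducedFDRep h2 hh hhh l) := by
  classical
  have := Fintype.ofFinite G
  have hne : ∃ x : F, l x * l x ≠ 1 := by
    by_contra! H
    refine hl (MonoidHom.ext fun x => ?_)
    obtain ⟨m, hm⟩ := hF.odd_orderOf h2 x.2
    have hx : x ^ (2 * m + 1) = 1 := by rw [← hm, Subgroup.orderOf_coe, pow_orderOf_eq_one]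
    have := congrArg l hx
    rwa [map_pow, pow_succ, pow_mul, pow_two, H x, one_pow, one_mul, map_one] at this
  have hlinv (x : F) : l x * l x⁻¹ = 1 := by rw [← map_mul, mul_inv_cancel, map_one]
  have hsum : ∑ x : F, l x * l x = 0 := by
    have := sum_hom_units_eq_zero (l * l) (fun H => by
      obtain ⟨x, hx⟩ := hne
      exact hx (DFunLike.congr_fun H x))
    exact this
  have hsum' : ∑ x : F, l x⁻¹ * l x⁻¹ = 0 := by
    rw [← hsum]
    exact Equiv.sum_comp (Equiv.inv F) (fun x => l x * l x)
  rw [FDRep.simple_iff_char_is_norm_one]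
  calc ∑ g : G, (inducedFDRep h2 hh hhh l).character g * (inducedFDRep h2 hh hhh l).character g⁻¹
      = ∑ g ∈ Finset.univ.filter (· ∈ F), (inducedFDRep h2 hh hhh l).character g *
          (inducedFDRep h2 hh hhh l).character g⁻¹ := by
        refine (Finset.sum_filter_of_ne fun g _ hg => ?_).symm
        by_contra hgF
        exact hg (by rw [inducedFDRep_character_of_notMem h2 hh hhh l hgF, zero_mul])
    _ = ∑ x : F, (inducedFDRep h2 hh hhh l).character x *
          (inducedFDRep h2 hh hhh l).character (x : G)⁻¹ :=
        Finset.sum_subtype _ (by simp) _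
    _ = ∑ x : F, (l x * l x + l x⁻¹ * l x⁻¹ + 2) := by
        refine Finset.sum_congr rfl fun x _ => ?_
        have := hF.inducedFDRep_character_coe h2 hh hhh l x⁻¹
        rw [Subgroup.coe_inv, inv_inv] at this
        rw [this, hF.inducedFDRep_character_coe h2 hh hhh l x]
        linear_combination 2 * hlinv x
    _ = Nat.card G := by
        rw [Finset.sum_add_distrib, Finset.sum_add_distrib, hsum, hsum', ← F.card_mul_index, h2]
        simp

end Induced

lemma isVanishing_iff_notMem_kernel {G : Type} [Group G] [Finite G] {F : Subgroup G}
    (hF : IsFrobeniusWithKernel G F) (hab : ∀ x y : F, x * y = y * x) (h2 : F.index = 2)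
    (g : G) : IsVanishing g ↔ g ∉ F := by
  refine ⟨fun ⟨V, _, hV⟩ hg => V.character_ne_zero_of_mem_kernel hF hab h2 hg hV, fun hg => ?_⟩
  have := (Subgroup.nontrivial_iff_ne_bot F).2 hF.2.1
  let _ : CommGroup F := { (inferInstance : Group F) with mul_comm := hab }
  obtain ⟨l, hl⟩ := exists_monoidHom_complex_ne_one F
  have hgg := hF.mul_self_eq_one h2 hg
  exact ⟨inducedFDRep h2 hg hgg l, hF.simple_inducedFDRep h2 hg hgg hl,
    inducedFDRep_character_of_notMem h2 hg hgg l hg⟩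

theorem stmt7 (G : Type) [Group G] [Finite G] (F : Subgroup G)
    (hF : IsFrobeniusWithKernel G F) (hab : ∀ x y : F, x * y = y * x)
    (h2 : F.index = 2) :
    {g : G | IsVanishing g} = {g : G | g ∉ F} ∧ pv G = 1 / 2 := by
  have hset : {g : G | IsVanishing g} = {g : G | g ∉ F} :=
    Set.ext (isVanishing_iff_notMem_kernel hF hab h2)
  refine ⟨hset, ?_⟩
  have hadd := Set.ncard_add_ncard_compl (F : Set G)
  have hcard := h2 ▸ F.card_mul_index
  have hFcard : (F : Set G).ncard = Nat.card F := rfl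
  have hcompl : {g : G | g ∉ F} = (F : Set G)ᶜ := rfl
  have hpos : 0 < Nat.card F := Nat.card_pos
  have hG : Nat.card G = 2 * ((F : Set G)ᶜ).ncard := by omega
  have hne : (((F : Set G)ᶜ).ncard : ℝ) ≠ 0 := Nat.cast_ne_zero.2 (by omega)
  rw [pv, hset, hcompl, hG]
  push_cast
  field_simp
end

section
/- For every integer n ≥ 3, nv(Sym_n) = nv(A_n); equivalently van(Sym_n) = (Sym_n − A_n) ∪ van(A_n), and consequently pv(A_n) = 2·pv(Sym_n) − 1. -/
open CategoryTheory

open Representation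

theorem isIrreducible_iff_forall_submodule {G V : Type*} [Monoid G] [AddCommGroup V] [Module ℂ V]
    (ρ : Representation ℂ G V) : ρ.IsIrreducible ↔
      Nontrivial V ∧ ∀ U : Submodule ℂ V, (∀ g, ∀ v ∈ U, ρ g v ∈ U) → U = ⊥ ∨ U = ⊤ := by
  constructor
  · intro h
    refine ⟨?_, fun U hU => ?_⟩
    · by_contra hV
      rw [not_nontrivial_iff_subsingleton] at hV
      exact bot_ne_top (α := Subrepresentation ρ) <|
        Subrepresentation.toSubmodule_injective (Subsingleton.elim _ _)
    · refine (h.eq_bot_or_eq_top ⟨U, fun g v hv => hU g v hv⟩).imp ?_ ?_ <;>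
        exact fun e => congrArg Subrepresentation.toSubmodule e
  · rintro ⟨hV, h⟩
    refine { exists_pair_ne := ⟨⊥, ⊤, fun e => ?_⟩, eq_bot_or_eq_top := fun U => ?_ }
    · exact bot_ne_top (α := Submodule ℂ V) (congrArg Subrepresentation.toSubmodule e)
    · refine (h U.toSubmodule fun g v hv => U.apply_mem_toSubmodule g hv).imp ?_ ?_ <;>
        exact fun e => Subrepresentation.toSubmodule_injective e

theorem isIrreducible_of_simple {G : Type} [Group G] (V : FDRep ℂ G) [Simple V] :
    Representation.IsIrreducible (V := V) V.ρ := by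
  rw [isIrreducible_iff_forall_submodule]
  constructor
  · by_contra hV
    rw [not_nontrivial_iff_subsingleton] at hV
    refine id_nonzero V ?_
    ext v
    exact Subsingleton.elim _ _
  · intro U hU
    let W : FDRep ℂ G := FDRep.of (Subrepresentation.toRepresentation (ρ := V.ρ) ⟨U, hU⟩)
    let f : W ⟶ V := ⟨InducedCategory.homMk (ModuleCat.ofHom U.subtype), fun g => by ext v; rfl⟩
    have hf : Mono f := by
      refine (forget (FDRep ℂ G)).mono_of_mono_map ?_
      rw [mono_iff_injective]
      exact Subtype.val_injective
    by_cases h0 : f = 0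
    · left
      rw [eq_bot_iff]
      intro v hv
      have := congrArg (fun k : W ⟶ V => k.hom.hom.hom ⟨v, hv⟩) h0
      exact this
    · right
      have := isIso_of_mono_of_nonzero h0
      rw [eq_top_iff]
      intro v _
      have hs : Function.Surjective ((forget (FDRep ℂ G)).map f) := by
        rw [← epi_iff_surjective]; infer_instance
      obtain ⟨w, rfl⟩ := hs v
      exact w.2

theorem simple_of_isIrreducible {G V : Type} [Group G] [Finite G] [AddCommGroup V] [Module ℂ V]
    [FiniteDimensional ℂ V] (ρ : Representation ℂ G V) [ρ.IsIrreducible] :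
    Simple (FDRep.of ρ) := by
  have : NeZero (Nat.card G : ℂ) := ⟨Nat.cast_ne_zero.mpr Nat.card_pos.ne'⟩
  rw [FDRep.simple_iff_end_is_rank_one,
    ← Representation.IsIrreducible.finrank_intertwiningMap_self ρ]
  exact (LinearEquiv.finrank_eq ((Rep.homLinearEquiv _ _).symm.trans
    (FDRep.forget₂HomLinearEquiv (FDRep.of ρ) (FDRep.of ρ)))).symm

theorem isVanishing_iff {G : Type} [Group G] [Finite G] (g : G) :
    IsVanishing g ↔ ∃ (V : Type) (_ : AddCommGroup V) (_ : Module ℂ V) (_ : FiniteDimensional ℂ V)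
      (ρ : Representation ℂ G V), ρ.IsIrreducible ∧ LinearMap.trace ℂ V (ρ g) = 0 := by
  constructor
  · rintro ⟨V, hV, h⟩
    exact ⟨V, inferInstance, inferInstance, inferInstance, V.ρ, isIrreducible_of_simple V, h⟩
  · rintro ⟨V, _, _, _, ρ, hρ, h⟩
    exact ⟨FDRep.of ρ, simple_of_isIrreducible ρ, h⟩

theorem exists_equivariant_projection {G V : Type*} [Group G] [Finite G] [AddCommGroup V]
    [Module ℂ V] (ρ : Representation ℂ G V) (U : Submodule ℂ V)
    (hU : ∀ g, ∀ v ∈ U, ρ g v ∈ U) :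
    ∃ π : V →ₗ[ℂ] V, (∀ g v, π (ρ g v) = ρ g (π v)) ∧ (∀ v, π v ∈ U) ∧ ∀ v ∈ U, π v = v := by
  have := Fintype.ofFinite G
  obtain ⟨p, hp⟩ := U.subtype.exists_leftInverse_of_injective U.ker_subtype
  have hp' : ∀ v (hv : v ∈ U), (p v : V) = v := fun v hv =>
    congrArg Subtype.val (LinearMap.congr_fun hp ⟨v, hv⟩)
  refine ⟨(Fintype.card G : ℂ)⁻¹ • ∑ g, ρ g ∘ₗ (U.subtype ∘ₗ p) ∘ₗ ρ g⁻¹, ?_, ?_, ?_⟩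
  · intro g v
    simp only [LinearMap.smul_apply, LinearMap.sum_apply, LinearMap.comp_apply, map_smul, map_sum]
    congr 1
    refine Fintype.sum_equiv (Equiv.mulLeft g⁻¹) _ _ fun x => ?_
    simp only [Equiv.coe_mulLeft, ← Module.End.mul_apply, ← map_mul]
    simp
  · intro v
    simp only [LinearMap.smul_apply, LinearMap.sum_apply, LinearMap.comp_apply]
    exact U.smul_mem _ (U.sum_mem fun g _ => hU _ _ (p _).2)
  · intro v hv
    simp only [LinearMap.smul_apply, LinearMap.sum_apply, LinearMap.comp_apply]
    rw [Finset.sum_congr rfl (g := fun _ => v)]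
    · simp [← Nat.cast_smul_eq_nsmul ℂ, smul_smul]
    · intro g _
      rw [Submodule.subtype_apply, hp' _ (hU _ _ hv), ← Module.End.mul_apply, ← map_mul]
      simp

/-- A nonzero vector of a finite-dimensional representation of a finite group survives in the
projection onto some irreducible direct summand. -/
theorem exists_irreducible_summand {G : Type*} [Group G] [Finite G] {U : Type}
    [AddCommGroup U] [Module ℂ U] [FiniteDimensional ℂ U] (σ : Representation ℂ G U) (u : U)
    (hu : u ≠ 0) :
    ∃ (V : Type) (_ : AddCommGroup V) (_ : Module ℂ V) (_ : FiniteDimensional ℂ V)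
      (ρ : Representation ℂ G V) (i : V →ₗ[ℂ] U) (φ : U →ₗ[ℂ] V), ρ.IsIrreducible ∧
      Function.Injective i ∧ (∀ g v, i (ρ g v) = σ g (i v)) ∧ (∀ g v, φ (σ g v) = ρ g (φ v)) ∧
      φ u ≠ 0 := by
  induction hn : Module.finrank ℂ U using Nat.strong_induction_on generalizing U with
  | _ n ih =>
  by_cases hσ : σ.IsIrreducible
  · exact ⟨U, inferInstance, inferInstance, inferInstance, σ, .id, .id, hσ,
      Function.injective_id, fun _ _ => rfl, fun _ _ => rfl, hu⟩
  rw [isIrreducible_iff_forall_submodule] at hσ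
  push Not at hσ
  obtain ⟨N, hN, hbot, htop⟩ := hσ ⟨u, 0, hu⟩
  obtain ⟨π, hπ, hπN, hπid⟩ := exists_equivariant_projection σ N hN
  obtain ⟨M, q, hM, hq, hqM, hMσ, hqu⟩ : ∃ (M : Submodule ℂ U) (q : U →ₗ[ℂ] U), M ≠ ⊤ ∧
      (∀ g v, q (σ g v) = σ g (q v)) ∧ (∀ v, q v ∈ M) ∧ (∀ g, ∀ v ∈ M, σ g v ∈ M) ∧
      q u ≠ 0 := by
    by_cases hπu : π u = 0
    · refine ⟨LinearMap.ker π, LinearMap.id - π, fun h => hbot ?_, ?_, ?_, ?_, ?_⟩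
      · rw [eq_bot_iff]
        intro v hv
        rw [← hπid v hv]
        exact LinearMap.mem_ker.mp (h ▸ Submodule.mem_top)
      · intro g v
        simp [hπ]
      · intro v
        simp [hπid _ (hπN v)]
      · intro g v hv
        rw [LinearMap.mem_ker] at hv ⊢
        rw [hπ, hv, map_zero]
      · simpa [hπu] using hu
    · exact ⟨N, π, htop, hπ, hπN, hN, hπu⟩
  obtain ⟨V, h1, h2, h3, ρ, i, φ, hρ, hi, hieq, hφ, hφu⟩ := ih _
    (hn ▸ Submodule.finrank_lt hM)
    (Subrepresentation.toRepresentation (ρ := σ) ⟨M, hMσ⟩) (q.codRestrict M hqM u)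
    (fun h => hqu (congrArg Subtype.val h)) rfl
  refine ⟨V, h1, h2, h3, ρ, M.subtype ∘ₗ i, φ ∘ₗ q.codRestrict M hqM, hρ,
    M.injective_subtype.comp hi, fun g v => ?_, fun g v => ?_, hφu⟩
  · simp only [LinearMap.comp_apply, hieq]
    rfl
  · simp only [LinearMap.comp_apply, ← hφ]
    congr 1
    exact Subtype.ext (hq g v)

/-- An equivariant map out of an irreducible representation is injective or zero. -/
theorem injective_of_equivariant_of_ne_zero {G V U : Type*} [Group G] [AddCommGroup V] [Module ℂ V]
    [AddCommGroup U] [Module ℂ U] {ρ : Representation ℂ G V} (hρ : ρ.IsIrreducible)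
    (σ : G → U →ₗ[ℂ] U) (f : V →ₗ[ℂ] U) (hf : ∀ g v, f (ρ g v) = σ g (f v)) {v : V}
    (hv : f v ≠ 0) : Function.Injective f := by
  rw [isIrreducible_iff_forall_submodule] at hρ
  rw [← LinearMap.ker_eq_bot]
  refine (hρ.2 (LinearMap.ker f) fun g w hw => ?_).resolve_right fun h => hv ?_
  · rw [LinearMap.mem_ker] at hw ⊢
    rw [hf, hw, map_zero]
  · exact LinearMap.mem_ker.mp (h ▸ Submodule.mem_top)

/-- The right translation representation on functions from a group to a vector space. -/
def rightTranslation (G W : Type*) [Group G] [AddCommGroup W] [Module ℂ W] :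
    Representation ℂ G (G → W) where
  toFun g := LinearMap.funLeft ℂ W (· * g)
  map_one' := by ext; simp [LinearMap.funLeft_apply]
  map_mul' x y := by ext; simp [LinearMap.funLeft_apply, mul_assoc]

@[simp]
theorem rightTranslation_apply {G W : Type*} [Group G] [AddCommGroup W] [Module ℂ W] (g : G)
    (f : G → W) (x : G) : rightTranslation G W g f x = f (x * g) := rfl

/-- Every irreducible representation of a subgroup occurs in the restriction of an irreducible
representation of the whole group. -/
theorem exists_irreducible_above {G : Type} [Group G] [Finite G] (H : Subgroup G) {W : Type}
    [AddCommGroup W] [Module ℂ W] [FiniteDimensional ℂ W] (σ : Representation ℂ H W)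
    (hσ : σ.IsIrreducible) :
    ∃ (V : Type) (_ : AddCommGroup V) (_ : Module ℂ V) (_ : FiniteDimensional ℂ V)
      (ρ : Representation ℂ G V) (i : W →ₗ[ℂ] V), ρ.IsIrreducible ∧
      Function.Injective i ∧ ∀ (h : H) v, i (σ h v) = ρ h (i v) := by
  classical
  let j : W →ₗ[ℂ] (G → W) := LinearMap.pi fun x => if hx : x ∈ H then σ ⟨x, hx⟩ else 0
  have hj : ∀ (h : H) w, j (σ h w) = rightTranslation G W h (j w) := by
    intro h w
    ext x
    simp only [j, LinearMap.pi_apply, rightTranslation_apply]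
    by_cases hx : x ∈ H
    · have hxh : x * h ∈ H := H.mul_mem hx h.2
      rw [dif_pos hx, dif_pos hxh, ← Module.End.mul_apply, ← map_mul]
      rfl
    · have hxh : x * h ∉ H := fun h' => hx ((H.mul_mem_cancel_right h.2).mp h')
      simp [hx, hxh]
  have := ((isIrreducible_iff_forall_submodule σ).mp hσ).1
  obtain ⟨w, hw⟩ := exists_ne (0 : W)
  have hjw : j w ≠ 0 := fun h => hw <| by
    have h1 := congrFun h 1
    simp only [j, LinearMap.pi_apply, dif_pos H.one_mem] at h1
    rwa [show (⟨1, H.one_mem⟩ : H) = 1 from rfl, map_one] at h1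
  obtain ⟨V, _, _, _, ρ, -, φ, hρ, -, -, hφ, hφu⟩ :=
    exists_irreducible_summand (rightTranslation G W) (j w) hjw
  have heq : ∀ (h : H) v, (φ ∘ₗ j) (σ h v) = ρ h ((φ ∘ₗ j) v) := by
    intro h v
    simp only [LinearMap.comp_apply, hj, hφ]
  exact ⟨V, inferInstance, inferInstance, inferInstance, ρ, φ ∘ₗ j, hρ,
    injective_of_equivariant_of_ne_zero hσ (fun h => ρ h) _ heq hφu, heq⟩

theorem exists_irreducible_below {G : Type} [Group G] [Finite G] (H : Subgroup G) {V : Type}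
    [AddCommGroup V] [Module ℂ V] [FiniteDimensional ℂ V] (ρ : Representation ℂ G V)
    (hρ : ρ.IsIrreducible) :
    ∃ (W : Type) (_ : AddCommGroup W) (_ : Module ℂ W) (_ : FiniteDimensional ℂ W)
      (σ : Representation ℂ H W) (i : W →ₗ[ℂ] V), σ.IsIrreducible ∧
      Function.Injective i ∧ ∀ (h : H) v, i (σ h v) = ρ h (i v) := by
  have := ((isIrreducible_iff_forall_submodule ρ).mp hρ).1
  obtain ⟨v, hv⟩ := exists_ne (0 : V)
  obtain ⟨W, h1, h2, h3, σ, i, -, hσ, hi, hieq, -⟩ :=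
    exists_irreducible_summand (ρ.comp H.subtype) v hv
  exact ⟨W, h1, h2, h3, σ, i, hσ, hi, hieq⟩

/-- Clifford theory for a subgroup `H` of index two, in terms of traces. -/
theorem trace_eq_or_trace_eq_add {G : Type} [Group G] (H : Subgroup G) (hH : H.index = 2)
    {V W : Type} [AddCommGroup V] [Module ℂ V] [FiniteDimensional ℂ V] [AddCommGroup W]
    [Module ℂ W] [FiniteDimensional ℂ W] (ρ : Representation ℂ G V) (hρ : ρ.IsIrreducible)
    (σ : Representation ℂ H W) (hσ : σ.IsIrreducible) (i : W →ₗ[ℂ] V)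
    (hi : Function.Injective i) (hieq : ∀ (h : H) v, i (σ h v) = ρ h (i v)) (τ : G)
    (hτ : τ ∉ H) :
    (∀ h : H, LinearMap.trace ℂ V (ρ h) = LinearMap.trace ℂ W (σ h)) ∨
    ∀ h h' : H, (h' : G) = τ⁻¹ * h * τ →
      LinearMap.trace ℂ V (ρ h) = LinearMap.trace ℂ W (σ h) + LinearMap.trace ℂ W (σ h') := by
  have hρ' := (isIrreducible_iff_forall_submodule ρ).mp hρ
  have hσ' := (isIrreducible_iff_forall_submodule σ).mp hσ
  have hnorm : H.Normal := Subgroup.normal_of_index_eq_two hH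
  have hmul : ∀ {a b : G}, a ∉ H → b ∉ H → a * b ∈ H := fun ha hb =>
    (Subgroup.mul_mem_iff_of_index_two hH).mpr (iff_of_false ha hb)
  have hρmul : ∀ a b v, ρ a (ρ b v) = ρ (a * b) v := fun a b v => by
    rw [map_mul, Module.End.mul_apply]
  have hconj : ∀ h : H, τ⁻¹ * h * τ ∈ H := fun h => by
    simpa using hnorm.conj_mem h h.2 τ⁻¹
  have hconjτ : ∀ (h : H) w, ρ h (ρ τ (i w)) = ρ τ (i (σ ⟨_, hconj h⟩ w)) := fun h w => by
    rw [hieq, hρmul, hρmul]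
    congr 2
    group
  -- the sum of the image of `i` and its translate is invariant
  have hsup : LinearMap.range i ⊔ LinearMap.range (ρ τ ∘ₗ i) = ⊤ := by
    refine (hρ'.2 _ fun g v hv => ?_).resolve_left fun h => ?_
    · obtain ⟨_, ⟨w, rfl⟩, _, ⟨w', rfl⟩, rfl⟩ := Submodule.mem_sup.mp hv
      rw [map_add, LinearMap.comp_apply]
      by_cases hg : g ∈ H
      · refine Submodule.add_mem _ (Submodule.mem_sup_left ⟨σ ⟨g, hg⟩ w, hieq _ _⟩)
          (Submodule.mem_sup_right ⟨_, (hconjτ ⟨g, hg⟩ w').symm⟩)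
      · have h1 : τ⁻¹ * g ∈ H := hmul (by simpa using hτ) hg
        refine Submodule.add_mem _ (Submodule.mem_sup_right ⟨σ ⟨_, h1⟩ w, ?_⟩)
          (Submodule.mem_sup_left ⟨σ ⟨_, hmul hg hτ⟩ w', ?_⟩)
        · rw [LinearMap.comp_apply, hieq, hρmul]
          congr 2
          group
        · rw [hieq, hρmul]
    · obtain ⟨w, hw⟩ := @exists_ne _ hσ'.1 (0 : W)
      have : i w ∈ (⊥ : Submodule ℂ V) := h ▸ Submodule.mem_sup_left ⟨w, rfl⟩
      exact hw (hi (by simpa using this))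
  rcases hσ'.2 ((LinearMap.range (ρ τ ∘ₗ i)).comap i) (by
    rintro h w ⟨w', hw'⟩
    refine ⟨σ ⟨_, hconj h⟩ w', ?_⟩
    rw [hieq, ← hw', LinearMap.comp_apply, LinearMap.comp_apply, hconjτ]) with h | h
  · right
    intro a a' ha
    let e : W × W →ₗ[ℂ] V := i.coprod (ρ τ ∘ₗ i)
    have he : Function.Bijective e := by
      constructor
      · rw [← LinearMap.ker_eq_bot, eq_bot_iff]
        rintro ⟨w, w'⟩ hw
        simp only [e, LinearMap.mem_ker, LinearMap.coprod_apply] at hw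
        have hw0 : w ∈ (LinearMap.range (ρ τ ∘ₗ i)).comap i :=
          ⟨-w', by rw [map_neg]; exact (eq_neg_of_add_eq_zero_left hw).symm⟩
        rw [h, Submodule.mem_bot] at hw0
        subst hw0
        have h2 : ρ τ⁻¹ (ρ τ (i w')) = 0 := by
          rw [show ρ τ (i w') = 0 by simpa using hw, map_zero]
        rw [hρmul, inv_mul_cancel, map_one, Module.End.one_apply] at h2
        have : w' = 0 := hi (by rw [h2, map_zero])
        simp [this]
      · rw [← LinearMap.range_eq_top, LinearMap.range_coprod, hsup]
    let E := LinearEquiv.ofBijective e he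
    rw [← LinearMap.trace_prodMap', ← LinearMap.trace_conj' _ E]
    congr 1
    ext v
    obtain ⟨⟨w, w'⟩, rfl⟩ := E.surjective v
    rw [LinearEquiv.conj_apply_apply, E.symm_apply_apply]
    change ρ a (i w + ρ τ (i w')) = i (σ a w) + ρ τ (i (σ a' w'))
    rw [map_add, hieq, hconjτ, show (⟨_, hconj a⟩ : H) = a' from Subtype.ext ha.symm]
  · left
    intro a
    have hle : LinearMap.range i ≤ LinearMap.range (ρ τ ∘ₗ i) := by
      rintro _ ⟨w, rfl⟩
      exact (h ▸ Submodule.mem_top : w ∈ (LinearMap.range (ρ τ ∘ₗ i)).comap i)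
    have hrank : Module.finrank ℂ (LinearMap.range (ρ τ ∘ₗ i)) ≤
        Module.finrank ℂ (LinearMap.range i) := by
      rw [LinearMap.finrank_range_of_inj hi]
      exact LinearMap.finrank_range_le _
    have heq := Submodule.eq_of_le_of_finrank_le hle hrank
    rw [← heq, sup_idem] at hsup
    let E := LinearEquiv.ofBijective i ⟨hi, LinearMap.range_eq_top.mp hsup⟩
    rw [← LinearMap.trace_conj' _ E]
    congr 1
    ext v
    obtain ⟨w, rfl⟩ := E.surjective v
    rw [LinearEquiv.conj_apply_apply, E.symm_apply_apply]
    exact (hieq a w).symm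

/-- If `g` commutes with an element outside a subgroup `H` of index two, then `g` is vanishing in
the whole group exactly if it is vanishing in `H`. -/
theorem isVanishing_iff_of_commute {G : Type} [Group G] [Finite G] (H : Subgroup G)
    (hH : H.index = 2) (g : H) (τ : G) (hτ : τ ∉ H) (hcomm : τ * g = g * τ) :
    IsVanishing (g : G) ↔ IsVanishing g := by
  have hg : (g : G) = τ⁻¹ * g * τ := by rw [mul_assoc, ← hcomm]; group
  rw [isVanishing_iff, isVanishing_iff]
  constructor
  · rintro ⟨V, _, _, _, ρ, hρ, h⟩
    obtain ⟨W, _, _, _, σ, i, hσ, hi, hieq⟩ := exists_irreducible_below H ρ hρ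
    refine ⟨W, inferInstance, inferInstance, inferInstance, σ, hσ, ?_⟩
    rcases trace_eq_or_trace_eq_add H hH ρ hρ σ hσ i hi hieq τ hτ with h' | h'
    · rw [← h', h]
    · rw [h' g g hg] at h
      exact add_self_eq_zero.mp h
  · rintro ⟨W, _, _, _, σ, hσ, h⟩
    obtain ⟨V, _, _, _, ρ, i, hρ, hi, hieq⟩ := exists_irreducible_above H σ hσ
    refine ⟨V, inferInstance, inferInstance, inferInstance, ρ, hρ, ?_⟩
    rcases trace_eq_or_trace_eq_add H hH ρ hρ σ hσ i hi hieq τ hτ with h' | h'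
    · rw [h', h]
    · rw [h' g g hg, h, add_zero]

/-- If the centralizer of `g₀` lies in the kernel of the sign-like character `ε`, then every
element outside the kernel is vanishing. -/
theorem isVanishing_of_sign_ne_one {G : Type} [Group G] [Finite G] (ε : G →* ℤˣ) (g₀ : G)
    (hg₀ : ∀ a, a * g₀ = g₀ * a → ε a = 1) {x : G} (hx : ε x ≠ 1) : IsVanishing x := by
  classical
  have := Fintype.ofFinite G
  have hx' : ε x = -1 := (Int.units_eq_one_or _).resolve_left hx
  let K : ∀ {V : Type} [AddCommGroup V] [Module ℂ V], Representation ℂ G V → V →ₗ[ℂ] V :=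
    fun ρ => ∑ a, (ε a : ℤ) • ρ (a * g₀ * a⁻¹)
  have hK : ∀ {V : Type} [AddCommGroup V] [Module ℂ V] (ρ : Representation ℂ G V) (y : G) (v : V),
      K ρ (ρ y v) = (ε y : ℤ) • ρ y (K ρ v) := by
    intro V _ _ ρ y v
    simp only [K, LinearMap.sum_apply, LinearMap.smul_apply, map_sum, Finset.smul_sum]
    refine Fintype.sum_equiv (Equiv.mulLeft y⁻¹) _ _ fun a => ?_
    rw [map_zsmul, smul_smul, ← Units.val_mul, ← map_mul, ← Module.End.mul_apply,
      ← Module.End.mul_apply, ← map_mul, ← map_mul]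
    simp [mul_assoc]
  have hne : K (rightTranslation G ℂ) (Pi.single 1 1) ≠ 0 := by
    intro h
    have h1 := congrFun h g₀⁻¹
    simp only [K, LinearMap.sum_apply, LinearMap.smul_apply, Finset.sum_apply, Pi.smul_apply,
      rightTranslation_apply, Pi.zero_apply] at h1
    have h2 : ∀ a : G, (ε a : ℤ) • (Pi.single 1 1 : G → ℂ) (g₀⁻¹ * (a * g₀ * a⁻¹)) =
        if a * g₀ = g₀ * a then 1 else 0 := by
      intro a
      by_cases ha : a * g₀ = g₀ * a
      · have e : g₀⁻¹ * (a * g₀ * a⁻¹) = 1 := by rw [ha]; group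
        rw [e, if_pos ha, hg₀ a ha]
        simp
      · have e : g₀⁻¹ * (a * g₀ * a⁻¹) ≠ 1 := fun e => ha <| by
          rwa [inv_mul_eq_one, eq_mul_inv_iff_mul_eq, eq_comm] at e
        rw [if_neg ha, Pi.single_eq_of_ne e, smul_zero]
    rw [Finset.sum_congr rfl fun a _ => h2 a, Finset.sum_boole, Nat.cast_eq_zero,
      Finset.card_eq_zero] at h1
    exact Finset.notMem_empty g₀ (h1 ▸ by simp)
  obtain ⟨V, _, _, _, ρ, i, φ, hρ, -, -, hφ, hφu⟩ := exists_irreducible_summand (rightTranslation G ℂ) _ hne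
  have hKφ : ∀ f, φ (K (rightTranslation G ℂ) f) = K ρ (φ f) := by
    intro f
    simp only [K, LinearMap.sum_apply, LinearMap.smul_apply, map_sum, map_zsmul, hφ]
  rw [hKφ] at hφu
  have hinj : Function.Injective (K ρ) := by
    refine injective_of_equivariant_of_ne_zero hρ (fun y => (ε y : ℤ) • ρ y) _ (fun y v => ?_) hφu
    rw [hK, LinearMap.smul_apply]
  let E := LinearEquiv.ofInjectiveEndo (K ρ) hinj
  rw [isVanishing_iff]
  refine ⟨V, inferInstance, inferInstance, inferInstance, ρ, hρ, ?_⟩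
  have hE : E.conj (ρ x) = -ρ x := by
    ext v
    obtain ⟨w, rfl⟩ := E.surjective v
    rw [LinearEquiv.conj_apply_apply, E.symm_apply_apply]
    change K ρ (ρ x w) = -ρ x (K ρ w)
    rw [hK, hx']
    simp
  have ht := LinearMap.trace_conj' (ρ x) E
  rw [hE, map_neg] at ht
  exact self_eq_neg.mp ht.symm

theorem trace_restrict_ker {M N : Type*} [AddCommGroup M] [Module ℂ M] [FiniteDimensional ℂ M]
    [AddCommGroup N] [Module ℂ N] [FiniteDimensional ℂ N] (B : M →ₗ[ℂ] N)
    (hB : Function.Surjective B) (f : M →ₗ[ℂ] M) (h : N →ₗ[ℂ] N) (hfh : B ∘ₗ f = h ∘ₗ B)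
    (hf : ∀ v ∈ LinearMap.ker B, f v ∈ LinearMap.ker B) :
    LinearMap.trace ℂ _ (f.restrict hf) = LinearMap.trace ℂ M f - LinearMap.trace ℂ N h := by
  obtain ⟨s, hs⟩ := B.exists_rightInverse_of_surjective (LinearMap.range_eq_top.mpr hB)
  have hs' : ∀ w, B (s w) = w := LinearMap.congr_fun hs
  let p : M →ₗ[ℂ] LinearMap.ker B := (LinearMap.id - s ∘ₗ B).codRestrict _ fun v => by
    simp [hs']
  have h1 : LinearMap.trace ℂ M (f ∘ₗ s ∘ₗ B) = LinearMap.trace ℂ N h := by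
    rw [← LinearMap.comp_assoc, LinearMap.trace_comp_comm', ← LinearMap.comp_assoc, hfh,
      LinearMap.comp_assoc, hs, LinearMap.comp_id]
  have h2 : LinearMap.trace ℂ M ((f ∘ₗ (LinearMap.ker B).subtype) ∘ₗ p) =
      LinearMap.trace ℂ _ (f.restrict hf) := by
    rw [LinearMap.trace_comp_comm']
    congr 1
    ext v
    have : B (f v) = 0 := hf v v.2
    simp [p, this]
  rw [← h1, ← h2, ← map_sub]
  congr 1
  ext v
  simp [p]

/-- The permutation representation attached to an action `a` of `G` on `X`. -/
def permRep {G X : Type*} [Group G] (a : G →* Equiv.Perm X) : Representation ℂ G (X → ℂ) where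
  toFun g := LinearMap.funLeft ℂ ℂ (a g⁻¹)
  map_one' := by ext; simp [LinearMap.funLeft_apply]
  map_mul' x y := by ext; simp [LinearMap.funLeft_apply]

theorem permRep_apply {G X : Type*} [Group G] (a : G →* Equiv.Perm X) (g : G) (f : X → ℂ) (x : X) :
    permRep a g f x = f ((a g)⁻¹ x) := by
  rw [← map_inv]; rfl

theorem permRep_single {G X : Type*} [Group G] [DecidableEq X] (a : G →* Equiv.Perm X) (g : G)
    (x : X) : permRep a g (Pi.single x 1) = Pi.single (a g x) 1 := by
  ext y
  simp only [permRep_apply, Pi.single_apply, Equiv.Perm.inv_eq_iff_eq]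

theorem trace_permRep {G X : Type*} [Group G] [Fintype X] [DecidableEq X] (a : G →* Equiv.Perm X)
    (g : G) : LinearMap.trace ℂ _ (permRep a g) = (Finset.univ.filter fun x => a g x = x).card := by
  rw [LinearMap.trace_eq_matrix_trace ℂ (Pi.basisFun ℂ X), Matrix.trace, ← Finset.sum_boole]
  refine Finset.sum_congr rfl fun x _ => ?_
  rw [Matrix.diag_apply, LinearMap.toMatrix_apply, Pi.basisFun_apply, permRep_single,
    Pi.basisFun_repr, Pi.single_apply]
  simp only [eq_comm]

theorem isIrreducible_of_forall_kernel {G X : Type*} [Group G] [Finite G] [Fintype X]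
    (a : G →* Equiv.Perm X) (V : Submodule ℂ (X → ℂ))
    (hV : ∀ g, ∀ v ∈ V, permRep a g v ∈ V) (hbot : V ≠ ⊥)
    (hs : ∀ m : X → X → ℂ, (∀ g x y, m (a g x) (a g y) = m x y) →
      ∃ c : ℂ, ∀ f ∈ V, ∀ x, ∑ y, f y * m x y = c * f x) :
    (Subrepresentation.toRepresentation (ρ := permRep a) ⟨V, hV⟩).IsIrreducible := by
  classical
  rw [isIrreducible_iff_forall_submodule]
  refine ⟨Submodule.nontrivial_iff_ne_bot.mpr hbot, fun U hU => ?_⟩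
  obtain ⟨π, hπ, hπU, hπid⟩ := exists_equivariant_projection (permRep a) (U.map V.subtype) (by
    rintro g _ ⟨v, hv, rfl⟩
    exact ⟨_, hU g v hv, rfl⟩)
  obtain ⟨c, hc⟩ := hs (fun x y => π (Pi.single y 1) x) (fun g x y => by
    rw [← permRep_single, hπ, permRep_apply]; simp)
  have hπc : ∀ f ∈ V, π f = c • f := by
    intro f hf
    ext x
    rw [LinearMap.pi_apply_eq_sum_univ π f, Finset.sum_apply, Pi.smul_apply, smul_eq_mul,
      ← hc f hf x]
    refine Finset.sum_congr rfl fun y _ => ?_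
    have hy : (fun z => if y = z then (1 : ℂ) else 0) = Pi.single y 1 := by
      ext z
      simp [Pi.single_apply, eq_comm]
    rw [Pi.smul_apply, smul_eq_mul, hy]
  by_cases h0 : U = ⊥
  · exact Or.inl h0
  right
  obtain ⟨u, hu, hu0⟩ := U.ne_bot_iff.mp h0
  have hu1 : π u = u := hπid _ ⟨u, hu, rfl⟩
  have hc1 : c = 1 := by
    have h2 : (c - 1) • (u : X → ℂ) = 0 := by
      rw [sub_smul, one_smul, ← hπc u u.2, hu1, sub_self]
    rcases smul_eq_zero.mp h2 with h3 | h3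
    · exact sub_eq_zero.mp h3
    · exact absurd (Subtype.ext h3) hu0
  rw [eq_top_iff]
  intro v _
  obtain ⟨w, hw, hwv⟩ := hπU v
  rw [hπc v v.2, hc1, one_smul] at hwv
  rwa [← Subtype.ext hwv]

theorem isVanishing_of_permRep {G X Y : Type} [Group G] [Finite G] [Fintype X] [Fintype Y]
    [DecidableEq X] [DecidableEq Y] (a : G →* Equiv.Perm X) (b : G →* Equiv.Perm Y)
    (B : (X → ℂ) →ₗ[ℂ] (Y → ℂ)) (hB : Function.Surjective B)
    (hBeq : ∀ g, B ∘ₗ permRep a g = permRep b g ∘ₗ B) (hcard : Fintype.card Y < Fintype.card X)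
    (hs : ∀ m : X → X → ℂ, (∀ g x y, m (a g x) (a g y) = m x y) →
      ∃ c : ℂ, ∀ f ∈ LinearMap.ker B, ∀ x, ∑ y, f y * m x y = c * f x) (g : G)
    (hg : (Finset.univ.filter fun x => a g x = x).card =
      (Finset.univ.filter fun y => b g y = y).card) : IsVanishing g := by
  have hV : ∀ g, ∀ v ∈ LinearMap.ker B, permRep a g v ∈ LinearMap.ker B := by
    intro g v hv
    have := LinearMap.congr_fun (hBeq g) v
    rw [LinearMap.mem_ker] at hv ⊢
    simpa [hv] using this
  rw [isVanishing_iff]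
  refine ⟨_, _, _, inferInstance, _, isIrreducible_of_forall_kernel a (LinearMap.ker B) hV
    (LinearMap.ker_ne_bot_of_finrank_lt (by simpa using hcard)) hs, ?_⟩
  change LinearMap.trace ℂ _ ((permRep a g).restrict (hV g)) = 0
  rw [trace_restrict_ker B hB _ _ (hBeq g), trace_permRep, trace_permRep, hg, sub_self]

open scoped Pointwise in
theorem exists_even_perm_smul_eq {α : Type*} [Fintype α] [DecidableEq α]
    (hα : 5 ≤ Fintype.card α) {p q p' q' : Finset α} (hp : p.card = p'.card)
    (hq : q.card = q'.card) (hpq : (p ∩ q).card = (p' ∩ q').card) :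
    ∃ σ ∈ alternatingGroup α, σ • p = p' ∧ σ • q = q' := by
  let c : Finset α → Finset α → α → Bool × Bool := fun s t x => (decide (x ∈ s), decide (x ∈ t))
  have hfiber : ∀ s t : Finset α, ∀ z, Fintype.card {x // c s t x = z} =
      match z with
      | (true, true) => (s ∩ t).card
      | (true, false) => s.card - (s ∩ t).card
      | (false, true) => t.card - (s ∩ t).card
      | (false, false) => Fintype.card α - (s.card + t.card - (s ∩ t).card) := by
    rintro s t ⟨_ | _, _ | _⟩ <;> rw [Fintype.card_subtype]
    · have h : (Finset.univ.filter fun x => c s t x = (false, false)) = (s ∪ t)ᶜ := by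
        ext x
        simp [c]
      rw [h, Finset.card_compl, Finset.card_union]
    · rw [← Finset.card_sdiff]
      congr 1
      ext x
      simp [c, and_comm]
    · rw [Finset.inter_comm, ← Finset.card_sdiff]
      congr 1
      ext x
      simp [c]
    · congr 1
      ext x
      simp [c]
  have hcard : ∀ z, Fintype.card {x // c p q x = z} = Fintype.card {x // c p' q' x = z} := by
    intro z
    rw [hfiber, hfiber, hp, hq, hpq]
  let σ : Equiv.Perm α := Equiv.ofFiberEquiv fun z => Fintype.equivOfCardEq (hcard z)
  have hσ : ∀ x, c p' q' (σ x) = c p q x := Equiv.ofFiberEquiv_map _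
  have hc : ∀ τ : Equiv.Perm α, (∀ x, c p' q' (τ x) = c p q x) → τ • p = p' ∧ τ • q = q' := by
    intro τ hτ
    constructor <;> ext x <;> rw [← Finset.inv_smul_mem_iff, ← τ.apply_symm_apply x] <;>
      have := hτ (τ.symm x) <;> simp_all [c]
  obtain ⟨u, v, huv, hcuv⟩ := Fintype.exists_ne_map_eq_of_card_lt (c p' q') (by simp; omega)
  rcases Int.units_eq_one_or (Equiv.Perm.sign σ) with h | h
  · exact ⟨σ, Equiv.Perm.mem_alternatingGroup.mpr h, hc σ hσ⟩
  · refine ⟨Equiv.swap u v * σ, Equiv.Perm.mem_alternatingGroup.mpr ?_, hc _ fun x => ?_⟩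
    · rw [map_mul, Equiv.Perm.sign_swap huv, h]
      rfl
    · rw [Equiv.Perm.mul_apply, ← hσ]
      rw [Equiv.swap_apply_def]
      split_ifs with h1 h2
      · rw [h1, hcuv]
      · rw [h2, hcuv]
      · rfl

theorem isVanishing_of_card_fixedPoints_eq_one {n : ℕ} (hn : 4 ≤ n) {G : Type} [Group G] [Finite G]
    (j : G →* Equiv.Perm (Fin n)) (hj : alternatingGroup (Fin n) ≤ j.range) (g : G)
    (hg : (Finset.univ.filter fun x => j g x = x).card = 1) : IsVanishing g := by
  let B : (Fin n → ℂ) →ₗ[ℂ] (Unit → ℂ) := LinearMap.pi fun _ => ∑ x, LinearMap.proj x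
  have hB : ∀ f y, B f y = ∑ x, f x := fun f y => by simp [B]
  have h2 := alternatingGroup.isMultiplyPretransitive (Fin n)
  have h2' : MulAction.IsMultiplyPretransitive (alternatingGroup (Fin n)) (Fin n) 2 :=
    MulAction.isMultiplyPretransitive_of_le (n := Nat.card (Fin n) - 2) (by simp; omega) (by simp)
  rw [MulAction.is_two_pretransitive_iff] at h2'
  refine isVanishing_of_permRep j (1 : G →* Equiv.Perm Unit) B ?_ ?_ (by simp; omega) ?_ g (by simpa)
  · intro w
    refine ⟨Pi.single ⟨0, by omega⟩ (w ()), ?_⟩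
    ext
    rw [hB]
    simp
  · intro g
    ext f y
    simp only [LinearMap.comp_apply, hB, permRep_apply]
    exact Equiv.sum_comp (j g)⁻¹ _
  · intro m hm
    have hm' : ∀ σ ∈ alternatingGroup (Fin n), ∀ x y, m (σ x) (σ y) = m x y := by
      intro σ hσ x y
      obtain ⟨g, rfl⟩ := hj hσ
      exact hm g x y
    let a : Fin n := ⟨0, by omega⟩
    let b : Fin n := ⟨1, by omega⟩
    have hab : a ≠ b := by simp [a, b]
    have hoff : ∀ x y, x ≠ y → m x y = m a b := by
      intro x y hxy
      obtain ⟨σ, hx, hy⟩ := h2' hab hxy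
      rw [← hx, ← hy]
      exact hm' σ σ.2 a b
    have hdiag : ∀ x, m x x = m a a := by
      intro x
      have : Nontrivial (Fin n) := ⟨a, b, hab⟩
      obtain ⟨y, hy⟩ := exists_ne x
      obtain ⟨σ, hx, -⟩ := h2' hab hy.symm
      rw [← hx]
      exact hm' σ σ.2 a a
    refine ⟨m a a - m a b, fun f hf x => ?_⟩
    have hf0 : ∑ y, f y = 0 := by rw [← hB f ()]; exact congrFun hf ()
    have hterm : ∀ y, f y * m x y = f y * m a b + if x = y then (m a a - m a b) * f y else 0 := by
      intro y
      split_ifs with h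
      · rw [← h, hdiag]; ring
      · rw [hoff x y h, add_zero]
    rw [Finset.sum_congr rfl fun y _ => hterm y, Finset.sum_add_distrib, ← Finset.sum_mul, hf0]
    simp

open scoped Pointwise in
theorem isVanishing_of_forall_pair_ne {n : ℕ} (hn : 5 ≤ n) {G : Type} [Group G] [Finite G]
    (j : G →* Equiv.Perm (Fin n)) (hj : alternatingGroup (Fin n) ≤ j.range) (g : G)
    (hg : ∀ x, j g x ≠ x) (hg2 : ∀ s : Finset (Fin n), s.card = 2 → j g • s ≠ s) :
    IsVanishing g := by
  classical
  let X := Set.powersetCard (Fin n) 2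
  have : Fintype X := Fintype.ofFinite X
  let a : G →* Equiv.Perm X := (MulAction.toPermHom (Equiv.Perm (Fin n)) X).comp j
  have ha : ∀ g (q : X), ((a g q : X) : Finset (Fin n)) = j g • (q : Finset (Fin n)) :=
    fun g q => Set.powersetCard.coe_smul
  let B : (X → ℂ) →ₗ[ℂ] (Fin n → ℂ) :=
    LinearMap.pi fun x => ∑ q : X, if x ∈ (q : Finset (Fin n)) then LinearMap.proj q else 0
  have hB : ∀ f x, B f x = ∑ q : X, if x ∈ (q : Finset (Fin n)) then f q else 0 := fun f y => by
    simp only [B, LinearMap.pi_apply, LinearMap.sum_apply]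
    refine Finset.sum_congr rfl fun q _ => ?_
    split_ifs <;> rfl
  have hBsingle : ∀ (q : X) x,
      B (Pi.single q 1) x = if x ∈ (q : Finset (Fin n)) then 1 else 0 := by
    intro q x
    rw [hB, Finset.sum_eq_single q]
    · simp
    · intro r _ hr
      simp [hr]
    · simp
  have hcard : n < Fintype.card X := by
    rw [← Nat.card_eq_fintype_card, Set.powersetCard.card, Nat.card_fin, Nat.choose_two_right,
      Nat.lt_iff_add_one_le, Nat.le_div_iff_mul_le two_pos]
    obtain ⟨k, rfl⟩ := Nat.exists_eq_add_of_le hn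
    rw [show 5 + k - 1 = 4 + k by omega]
    nlinarith
  refine isVanishing_of_permRep a j B ?_ ?_ (by rwa [Fintype.card_fin]) ?_ g ?_
  · have hrange : ∀ x, Pi.single x 1 ∈ LinearMap.range B := by
      intro x
      obtain ⟨y, z, hxy, hxz, hyz⟩ : ∃ y z, x ≠ y ∧ x ≠ z ∧ y ≠ z := by
        have h1 : 1 < ({x}ᶜ : Finset (Fin n)).card := by
          rw [Finset.card_compl]; simp; omega
        obtain ⟨y, hy, z, hz, hyz⟩ := Finset.one_lt_card.mp h1
        exact ⟨y, z, by simpa [eq_comm] using hy, by simpa [eq_comm] using hz, hyz⟩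
      refine ⟨(2⁻¹ : ℂ) • (Pi.single (⟨{x, y}, Finset.card_pair hxy⟩ : X) 1 +
        Pi.single (⟨{x, z}, Finset.card_pair hxz⟩ : X) 1 -
        Pi.single (⟨{y, z}, Finset.card_pair hyz⟩ : X) 1), ?_⟩
      ext w
      simp only [map_smul, map_add, map_sub, Pi.smul_apply, Pi.add_apply, Pi.sub_apply, hBsingle,
        Finset.mem_insert, Finset.mem_singleton, Pi.single_apply, smul_eq_mul]
      by_cases hw : w = x
      · subst hw; simp [hxy, hxz]; norm_num
      by_cases hw' : w = y
      · subst hw'; simp [hw, hyz]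
      simp [hw, hw']
    rw [← LinearMap.range_eq_top, eq_top_iff]
    intro w _
    rw [pi_eq_sum_univ' w]
    refine Submodule.sum_mem _ fun x _ => Submodule.smul_mem _ _ ?_
    convert hrange x using 1
  · intro g
    refine LinearMap.ext fun f => funext fun x => ?_
    simp only [LinearMap.comp_apply, hB, permRep_apply]
    refine Fintype.sum_equiv (a g)⁻¹ _ _ fun q => ?_
    have h : x ∈ (q : Finset (Fin n)) ↔
        (j g)⁻¹ x ∈ (((a g)⁻¹ q : X) : Finset (Fin n)) := by
      rw [← map_inv a, ha, map_inv, ← Equiv.Perm.smul_def, Finset.smul_mem_smul_finset_iff]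
    simp only [h]
  · intro m hm
    obtain ⟨c, hc⟩ : ∃ c : ℕ → ℂ, ∀ p q : X, m p q = c ((p : Finset (Fin n)) ∩ q).card := by
      obtain ⟨c, hc⟩ := (Function.factorsThrough_iff (Function.uncurry m)
        (f := fun r : X × X => ((r.1 : Finset (Fin n)) ∩ r.2).card)).mp (by
        rintro ⟨p, q⟩ ⟨p', q'⟩ h
        obtain ⟨σ, hσ, h1, h2⟩ := exists_even_perm_smul_eq (by simpa) (p.2.trans p'.2.symm)
          (q.2.trans q'.2.symm) h
        obtain ⟨g, rfl⟩ := hj hσ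
        rw [← ha] at h1 h2
        change m p q = m p' q'
        rw [← hm g, Subtype.ext h1, Subtype.ext h2])
      exact ⟨c, fun p q => congrFun hc (p, q)⟩
    refine ⟨c 2 - 2 * c 1 + c 0, fun f hf p => ?_⟩
    have hinter : ∀ s : Finset (Fin n), ∑ q : X, f q * ((s ∩ q).card : ℂ) = 0 := by
      intro s
      have h1 : ∀ q : X, f q * ((s ∩ q).card : ℂ) =
          ∑ x ∈ s, if x ∈ (q : Finset (Fin n)) then f q else 0 := by
        intro q
        rw [← Finset.sum_filter, Finset.filter_mem_eq_inter, Finset.sum_const, nsmul_eq_mul,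
          mul_comm]
      rw [Finset.sum_congr rfl fun q _ => h1 q, Finset.sum_comm]
      refine Finset.sum_eq_zero fun x _ => ?_
      rw [← hB]
      exact congrFun hf x
    have hsum : ∑ q, f q = 0 := by
      have h1 := hinter Finset.univ
      simp only [Finset.univ_inter, Set.powersetCard.card_eq, ← Finset.sum_mul] at h1
      simpa using h1
    have hterm : ∀ q, f q * m p q = f q * c 0 +
        (c 1 - c 0) * (f q * (((p : Finset (Fin n)) ∩ q).card : ℂ)) +
        if p = q then (c 2 - 2 * c 1 + c 0) * f q else 0 := by
      intro q
      rw [hc]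
      have hle : ((p : Finset (Fin n)) ∩ q).card ≤ 2 :=
        (Finset.card_le_card Finset.inter_subset_left).trans p.2.le
      split_ifs with h
      · rw [← h, Finset.inter_self, Set.powersetCard.card_eq]
        push_cast
        ring
      · have hne : ((p : Finset (Fin n)) ∩ q).card ≠ 2 := fun h2 => h <| by
          rw [Set.powersetCard.eq_iff_subset]
          exact Finset.inter_eq_left.mp
            (Finset.eq_of_subset_of_card_le Finset.inter_subset_left (by rw [h2]; exact p.2.le))
        generalize ((p : Finset (Fin n)) ∩ q).card = k at *
        interval_cases k
        · simp
        · push_cast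
          ring
        · exact absurd rfl hne
    rw [Finset.sum_congr rfl fun q _ => hterm q, Finset.sum_add_distrib, Finset.sum_add_distrib,
      ← Finset.sum_mul, ← Finset.mul_sum, hsum, hinter]
    simp
  · rw [Finset.card_eq_zero.mpr, Finset.card_eq_zero.mpr]
    · simpa [Finset.filter_eq_empty_iff] using hg
    · rw [Finset.filter_eq_empty_iff]
      intro q _ h
      exact hg2 q q.2 (by rw [← ha, h])

theorem trace_pow_eq_one {G : Type} [Group G] [IsMulCommutative G] {V : Type} [AddCommGroup V]
    [Module ℂ V] [FiniteDimensional ℂ V] (ρ : Representation ℂ G V) (hρ : ρ.IsIrreducible) (g : G)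
    {k : ℕ} (hg : g ^ k = 1) : LinearMap.trace ℂ V (ρ g) ^ k = 1 := by
  have h1 := IsIrreducible.finrank_eq_one_of_isMulCommutative ρ
  have := ((isIrreducible_iff_forall_submodule ρ).mp hρ).1
  obtain ⟨c, hc, -⟩ := LinearMap.existsUnique_eq_smul_id_of_finrank_eq_one h1 (ρ g)
  have htr : LinearMap.trace ℂ V (ρ g) = c := by rw [hc]; simp [h1]
  have hpow : ρ g ^ k = 1 := by rw [← map_pow, hg, map_one]
  obtain ⟨v, hv⟩ := exists_ne (0 : V)
  have h2 := congrArg (fun f : Module.End ℂ V => f v) hpow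
  rw [hc, smul_pow, ← Module.End.one_eq_id, one_pow] at h2
  rw [htr]
  refine smul_left_injective ℂ hv ?_
  simpa using h2

theorem not_isVanishing_of_odd_card {G : Type} [Group G] [Finite G] (H : Subgroup G)
    (hH : H.index = 2) [IsMulCommutative H] (hodd : Odd (Nat.card H)) (g : H) :
    ¬ IsVanishing (g : G) ∧ ¬ IsVanishing g := by
  have hroot : ∀ {W : Type} [AddCommGroup W] [Module ℂ W] [FiniteDimensional ℂ W]
      (σ : Representation ℂ H W), σ.IsIrreducible → ∀ h : H,
      LinearMap.trace ℂ W (σ h) ^ Nat.card H = 1 :=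
    fun σ hσ h => trace_pow_eq_one σ hσ h pow_card_eq_one'
  have hne : ∀ {z : ℂ}, z ^ Nat.card H = 1 → z ≠ 0 := fun h h0 => by
    rw [h0, zero_pow hodd.pos.ne'] at h
    exact zero_ne_one h
  have hnormal : H.Normal := Subgroup.normal_of_index_eq_two hH
  rw [isVanishing_iff, isVanishing_iff]
  constructor
  · rintro ⟨V, _, _, _, ρ, hρ, h⟩
    obtain ⟨W, _, _, _, σ, i, hσ, hi, hieq⟩ := exists_irreducible_below H ρ hρ
    obtain ⟨τ, hτ⟩ : ∃ τ, τ ∉ H := by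
      by_contra! hall
      rw [(Subgroup.eq_top_iff' H).mpr hall, Subgroup.index_top] at hH
      omega
    rcases trace_eq_or_trace_eq_add H hH ρ hρ σ hσ i hi hieq τ hτ with h' | h'
    · exact hne (hroot σ hσ g) ((h' g).symm.trans h)
    · have h2 := h' g ⟨τ⁻¹ * g * τ, by simpa using hnormal.conj_mem g g.2 τ⁻¹⟩ rfl
      rw [h, eq_comm, add_eq_zero_iff_eq_neg] at h2
      have h3 := hroot σ hσ g
      rw [h2, hodd.neg_pow, hroot σ hσ] at h3
      norm_num at h3
  · rintro ⟨W, _, _, _, σ, hσ, h⟩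
    exact hne (hroot σ hσ g) h

theorem isVanishing_of_notMem_alternatingGroup {n : ℕ} (hn : 3 ≤ n) {g : Equiv.Perm (Fin n)}
    (hg : g ∉ alternatingGroup (Fin n)) : IsVanishing g := by
  obtain ⟨m, hm, hmn, h2, hle⟩ : ∃ m, Odd m ∧ m ≤ n ∧ 2 ≤ m ∧ n ≤ m + 1 := by
    rcases Nat.even_or_odd n with h | h
    · have : 4 ≤ n := by
        obtain ⟨k, rfl⟩ := h
        omega
      exact ⟨n - 1, by rw [Nat.odd_sub (by omega)]; simp [h], by omega, by omega, by omega⟩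
    · exact ⟨n, h, le_rfl, by omega, by omega⟩
  obtain ⟨g₀, hg₀⟩ := (Equiv.Perm.exists_with_cycleType_iff (Fin n) (m := {m})).mpr
    (by simpa using ⟨hmn, h2⟩)
  have hcent : Subgroup.centralizer {g₀} ≤ alternatingGroup (Fin n) := by
    rw [Equiv.Perm.centralizer_le_alternating_iff, hg₀]
    refine ⟨by simpa using hm, by simpa using hle, fun i => ?_⟩
    rw [Multiset.count_singleton]
    split_ifs <;> omega
  refine isVanishing_of_sign_ne_one Equiv.Perm.sign g₀ (fun a ha => ?_)
    (by rwa [Equiv.Perm.mem_alternatingGroup] at hg)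
  rw [← Equiv.Perm.mem_alternatingGroup]
  exact hcent (Subgroup.mem_centralizer_singleton_iff.mpr ha)

open scoped Pointwise in
theorem isVanishing_of_forall_commute_even {n : ℕ} (hn : 4 ≤ n) {G : Type} [Group G] [Finite G]
    (j : G →* Equiv.Perm (Fin n)) (hj : alternatingGroup (Fin n) ≤ j.range) (g : G)
    (hmem : j g ∈ alternatingGroup (Fin n))
    (hg : ∀ τ, τ * j g = j g * τ → τ ∈ alternatingGroup (Fin n)) : IsVanishing g := by
  have hswap : ∀ x y, x ≠ y → ({j g x, j g y} : Finset (Fin n)) ≠ {x, y} := by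
    intro x y hxy h
    have hcomm : Equiv.swap x y * j g = j g * Equiv.swap x y := by
      rw [Equiv.mul_swap_eq_swap_mul]
      rw [← Finset.coe_inj, Finset.coe_pair, Finset.coe_pair, Set.pair_eq_pair_iff] at h
      rcases h with ⟨h1, h2⟩ | ⟨h1, h2⟩
      · rw [h1, h2]
      · rw [h1, h2, Equiv.swap_comm]
    have := hg _ hcomm
    rw [Equiv.Perm.mem_alternatingGroup, Equiv.Perm.sign_swap hxy] at this
    exact absurd this (by decide)
  have hle : (Finset.univ.filter fun x => j g x = x).card ≤ 1 := by
    rw [Finset.card_le_one]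
    intro x hx y hy
    by_contra hxy
    simp only [Finset.mem_filter, Finset.mem_univ, true_and] at hx hy
    exact hswap x y hxy (by rw [hx, hy])
  rcases hle.lt_or_eq with h0 | h1
  · have hfix : ∀ x, j g x ≠ x := by
      simpa [Finset.filter_eq_empty_iff] using h0
    rcases hn.lt_or_eq with h5 | rfl
    · refine isVanishing_of_forall_pair_ne h5 j hj g hfix fun s hs h => ?_
      obtain ⟨x, y, hxy, rfl⟩ := Finset.card_eq_two.mp hs
      refine hswap x y hxy ?_
      simpa [Finset.smul_finset_insert] using h
    · have key : ∀ π : Equiv.Perm (Fin 4), Equiv.Perm.sign π = 1 →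
          (∀ τ, τ * π = π * τ → Equiv.Perm.sign τ = 1) → ∃ x, π x = x := by decide
      obtain ⟨x, hx⟩ := key (j g) hmem hg
      exact absurd hx (hfix x)
  · exact isVanishing_of_card_fixedPoints_eq_one hn j hj g h1

theorem isVanishing_coe_alternatingGroup_iff {n : ℕ} (hn : 3 ≤ n)
    (g : alternatingGroup (Fin n)) : IsVanishing (g : Equiv.Perm (Fin n)) ↔ IsVanishing g := by
  have : Nontrivial (Fin n) := Fin.nontrivial_iff_two_le.mpr (by omega)
  have hindex := alternatingGroup.index_eq_two (α := Fin n)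
  by_cases hτ : ∀ τ, τ * (g : Equiv.Perm (Fin n)) = g * τ → τ ∈ alternatingGroup (Fin n)
  · rcases hn.lt_or_eq with h4 | rfl
    · refine iff_of_true ?_ ?_
      · exact isVanishing_of_forall_commute_even h4 (MonoidHom.id (Equiv.Perm (Fin n)))
          (fun σ _ => ⟨σ, rfl⟩) _ g.2 hτ
      · exact isVanishing_of_forall_commute_even h4 (alternatingGroup (Fin n)).subtype
          (Subgroup.range_subtype _).ge _ g.2 hτ
    · have := alternatingGroup.isMulCommutative_of_card_le_three (α := Fin 3) (by simp)
      have hcard : Nat.card (alternatingGroup (Fin 3)) = 3 := by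
        rw [nat_card_alternatingGroup, Nat.card_fin]
        rfl
      have h := not_isVanishing_of_odd_card _ hindex (by rw [hcard]; decide) g
      exact iff_of_false h.1 h.2
  · push Not at hτ
    obtain ⟨τ, hcomm, hτ⟩ := hτ
    exact isVanishing_iff_of_commute _ hindex g τ hτ hcomm

theorem setOf_isVanishing_perm_eq {n : ℕ} (hn : 3 ≤ n) :
    {g : Equiv.Perm (Fin n) | IsVanishing g} = (alternatingGroup (Fin n) : Set _)ᶜ ∪
      Set.image Subtype.val {g : alternatingGroup (Fin n) | IsVanishing g} := by
  ext g
  simp only [Set.mem_ofPred_eq, Set.mem_union, Set.mem_compl_iff, SetLike.mem_coe, Set.mem_image,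
    Subtype.exists, exists_and_right, exists_eq_right]
  by_cases hg : g ∈ alternatingGroup (Fin n)
  · simp only [hg, not_true, false_or, exists_true_left]
    exact isVanishing_coe_alternatingGroup_iff hn ⟨g, hg⟩
  · exact iff_of_true (isVanishing_of_notMem_alternatingGroup hn hg) (.inl hg)

theorem stmt9 (n : ℕ) (hn : 3 ≤ n) :
    (∀ g : Equiv.Perm (Fin n), ¬ IsVanishing g ↔
      ∃ h : g ∈ alternatingGroup (Fin n),
        ¬ IsVanishing (⟨g, h⟩ : alternatingGroup (Fin n))) ∧
    pv (alternatingGroup (Fin n)) = 2 * pv (Equiv.Perm (Fin n)) - 1 := by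
  constructor
  · intro g
    constructor
    · intro h
      have hg : g ∈ alternatingGroup (Fin n) := by
        by_contra hg
        exact h (isVanishing_of_notMem_alternatingGroup hn hg)
      exact ⟨hg, by rwa [← isVanishing_coe_alternatingGroup_iff hn]⟩
    · rintro ⟨hg, h⟩
      rwa [← isVanishing_coe_alternatingGroup_iff hn] at h
  · have : Nontrivial (Fin n) := Fin.nontrivial_iff_two_le.mpr (by omega)
    have hS := two_mul_nat_card_alternatingGroup (α := Fin n)
    have hpos : (Nat.card (alternatingGroup (Fin n)) : ℝ) ≠ 0 := by
      exact_mod_cast Nat.card_pos.ne'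
    have hvan : Set.ncard {g : Equiv.Perm (Fin n) | IsVanishing g} =
        Nat.card (alternatingGroup (Fin n)) +
          Set.ncard {g : alternatingGroup (Fin n) | IsVanishing g} := by
      rw [setOf_isVanishing_perm_eq hn, Set.ncard_union_eq,
        Set.ncard_image_of_injective _ Subtype.val_injective]
      · congr 1
        have h1 := Set.ncard_add_ncard_compl (alternatingGroup (Fin n) : Set (Equiv.Perm (Fin n)))
        have h2 : (alternatingGroup (Fin n) : Set (Equiv.Perm (Fin n))).ncard =
          Nat.card (alternatingGroup (Fin n)) := rfl
        omega
      · rw [Set.disjoint_left]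
        rintro _ hx ⟨y, -, rfl⟩
        exact hx y.2
    unfold pv
    rw [hvan, ← hS]
    push_cast
    field_simp
    ring
end

section
/- Let g ∈ Sym_n and suppose for some r ≥ 1 and a ≥ 0 there exists an r-core partition μ of n − ar. If g has more than a cycles of length r, then g is a vanishing element of Sym_n: the irreducible character labeled by the partition obtained by adding ar to the first part of μ vanishes at g. -/
open CategoryTheory

/-- The hook length of the cell `(i, j)` of a Young diagram. -/
def hookLength (Y : YoungDiagram) (i j : ℕ) : ℕ :=
  (Y.rowLen i - j) + (Y.colLen j - i) - 1

/-- A Young diagram is an `r`-core if no hook length is divisible by `r`. -/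
def IsRCore (r : ℕ) (Y : YoungDiagram) : Prop :=
  ∀ c ∈ Y.cells, ¬ (r ∣ hookLength Y c.1 c.2)

open Matrix in
/-- **Cauchy's determinant formula**, for the matrix with entries `1 / (1 - x i * y j)`. -/
theorem det_cauchy {A : Type*} [CommRing A] : ∀ {h : ℕ} (x y : Fin h → A) (c : Fin h → Fin h → A),
    (∀ i j, c i j * (1 - x i * y j) = 1) →
    (Matrix.of c).det = (vandermonde x).det * (vandermonde y).det * ∏ i, ∏ j, c i j
  | 0, x, y, c, _ => by simp
  | h + 1, x, y, c, hc => by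
    set N : Matrix (Fin (h + 1)) (Fin (h + 1)) A :=
      of fun i j => Fin.cases 1 (fun j => x i * c i j.succ) j with hN
    set d : Fin (h + 1) → A := Fin.cases 1 (fun j => y j.succ - y 0) with hd
    set N' : Matrix (Fin (h + 1)) (Fin (h + 1)) A :=
      of fun i j => Fin.cases (N 0 j) (fun i => N i.succ j - N 0 j) i with hN'
    have h1 : (of c).det = (of fun i j => c i 0 *
        (of fun i j => d j * N i j : Matrix _ _ A) i j).det := by
      refine (det_transpose _).symm.trans (Eq.trans ?_ (det_transpose _))
      refine det_eq_of_forall_row_eq_smul_add_const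
        (fun j => Fin.cases 0 (fun _ => 1) j) 0 (by simp) ?_
      intro j i
      refine Fin.cases ?_ (fun j => ?_) j
      · simp [hd, hN]
      · simp [hd, hN]
        linear_combination c i 0 * hc i j.succ - c i j.succ * hc i 0
    have h2 : N.det = N'.det := by
      refine det_eq_of_forall_row_eq_smul_add_const
        (fun j => Fin.cases 0 (fun _ => 1) j) 0 (by simp) ?_
      intro i j
      refine Fin.cases ?_ (fun i => ?_) i <;> simp [hN']
    have h3 : N'.det = (of fun i j : Fin h => (x i.succ - x 0) *
        (of fun i j : Fin h => c 0 j.succ *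
          (of fun i j : Fin h => c i.succ j.succ : Matrix _ _ A) i j : Matrix _ _ A) i j).det := by
      rw [det_succ_column_zero, Fin.sum_univ_succ]
      simp only [hN', hN, of_apply, Fin.cases_zero, Fin.cases_succ, sub_self, mul_zero, zero_mul,
        Finset.sum_const_zero, add_zero]
      simp
      congr 1
      ext i j
      simp
      linear_combination x 0 * c 0 j.succ * hc i.succ j.succ -
        x i.succ * c i.succ j.succ * hc 0 j.succ
    rw [h1, det_mul_column, det_mul_row, h2, h3, det_mul_column, det_mul_row,
      det_cauchy (fun i => x i.succ) (fun i => y i.succ) (fun i j => c i.succ j.succ)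
        (fun i j => hc _ _)]
    simp only [det_vandermonde, Fin.prod_univ_succ, hd, Fin.cases_zero, Fin.cases_succ,
      Fin.prod_Ioi_zero, Fin.prod_Ioi_succ, Finset.prod_mul_distrib]
    ring

open Matrix Finset PowerSeries in
/-- The Cauchy identity in degree `n`, multiplied by the two Vandermonde determinants. -/
theorem cauchy_identity {R : Type*} [CommRing R] {h : ℕ} (x y : Fin h → R) (n : ℕ) :
    (vandermonde x).det * (vandermonde y).det *
      ∑ M ∈ piAntidiag univ n, ∏ t : Fin h × Fin h, (x t.1 * y t.2) ^ M t =
    ∑ σ : Equiv.Perm (Fin h), Equiv.Perm.sign σ •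
      ∑ m ∈ piAntidiag univ (n + ∑ i : Fin h, (i : ℕ)), ∏ i, (x (σ i) * y i) ^ m i := by
  have geom (a : R) : (mk fun k => a ^ k) * (1 - C a * X) = 1 := by
    have := congrArg (rescale a) (mk_one_mul_one_sub_eq_one R)
    rw [map_mul, map_sub, map_one, rescale_X] at this
    refine Eq.trans ?_ this
    congr 1
    ext k
    simp
  have key := det_cauchy (fun i => C (x i)) (fun j => C (y j) * X)
    (fun i j => (mk fun k => (x i * y j) ^ k : R⟦X⟧)) (fun i j => by
      simpa only [map_mul, mul_assoc] using geom (x i * y j))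
  have coeff_geom {ι : Type} [Fintype ι] [DecidableEq ι] (a : ι → R) (N : ℕ) :
      coeff N (∏ t, (mk fun k => a t ^ k : R⟦X⟧)) = ∑ m ∈ piAntidiag univ N, ∏ t, a t ^ m t := by
    rw [coeff_prod]
    refine Finset.sum_bij (fun l _ => ⇑l) ?_ ?_ ?_ ?_
    · simp +contextual [mem_finsuppAntidiag]
    · intro l _ l' _ h
      exact DFunLike.coe_injective h
    · intro m hm
      exact ⟨Finsupp.equivFunOnFinite.symm m, by simpa [mem_finsuppAntidiag] using hm, rfl⟩
    · simp
  have hV : (vandermonde fun j => C (y j) * X).det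
      = C ((vandermonde y).det) * (X : R⟦X⟧) ^ (∑ i : Fin h, (i : ℕ)) := by
    rw [show (vandermonde fun j => C (y j) * X) = of fun i j : Fin h => (X : R⟦X⟧) ^ (j : ℕ) *
      (C.mapMatrix (vandermonde y)) i j by ext1 i j; simp [vandermonde_apply, mul_pow, mul_comm],
      det_mul_row, ← RingHom.map_det, Finset.prod_pow_eq_pow_sum, mul_comm]
  have hV' : (vandermonde fun j => C (x j)).det = (C ((vandermonde x).det) : R⟦X⟧) := by
    rw [RingHom.map_det]
    congr 1
    ext1 i j
    simp [vandermonde_apply]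
  rw [hV, hV', det_apply, ← Fintype.prod_prod_type'] at key
  apply_fun coeff (n + ∑ i : Fin h, (i : ℕ)) at key
  rw [show ∀ a b c d : R⟦X⟧, a * (b * c) * d = a * (b * (d * c)) by intros; ring,
    coeff_C_mul, coeff_C_mul, coeff_mul_X_pow, coeff_geom] at key
  rw [mul_assoc, ← key, map_sum]
  refine Finset.sum_congr rfl fun σ _ => ?_
  rw [Units.smul_def, Units.smul_def, map_zsmul]
  simp only [of_apply]
  rw [coeff_geom]

section Coloring

open Finset Equiv

/-- The sum, over the colourings of `α` by `κ` which are constant on the cycles of `g`, of the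
product of the weights of the colours. For indeterminate weights this is the power sum symmetric
polynomial of the cycle type of `g`. -/
def coloringSum {α κ R : Type*} [Fintype α] [DecidableEq α] [Fintype κ]
    [DecidableEq κ] [CommSemiring R] (z : κ → R) (g : Perm α) : R :=
  ∑ f : α → κ with f ∘ g = f, ∏ k, z (f k)

variable {α κ ν R S : Type*} [Fintype α] [DecidableEq α] [Fintype κ] [DecidableEq κ]
  [Fintype ν] [DecidableEq ν] [CommSemiring R] [CommSemiring S]

theorem map_coloringSum (φ : R →+* S) (z : κ → R) (g : Perm α) :
    φ (coloringSum z g) = coloringSum (fun t => φ (z t)) g := by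
  simp [coloringSum]

theorem coloringSum_mul (x : κ → R) (y : ν → R) (g : Perm α) :
    coloringSum (fun t : κ × ν => x t.1 * y t.2) g = coloringSum x g * coloringSum y g := by
  rw [coloringSum, coloringSum, coloringSum, Finset.sum_mul_sum, ← Finset.sum_product']
  refine Finset.sum_nbij' (fun f => (fun k => (f k).1, fun k => (f k).2))
    (fun f k => (f.1 k, f.2 k)) ?_ ?_ ?_ ?_ ?_
  · intro f hf
    simp only [mem_filter, mem_univ, true_and, mem_product, funext_iff, Function.comp_apply] at hf ⊢
    simp [hf]
  · intro f hf
    simp only [mem_filter, mem_univ, true_and, mem_product, funext_iff, Function.comp_apply] at hf ⊢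
    simp [hf]
  · intro f _; rfl
  · intro f _; rfl
  · intro f _
    simp [Finset.prod_mul_distrib]

theorem prod_X_pow_eq_monomial (S : Type*) [CommSemiring S] {κ : Type*} [Fintype κ] (f : κ → ℕ) :
    ∏ t, (MvPolynomial.X t : MvPolynomial κ S) ^ f t =
      MvPolynomial.monomial (Finsupp.equivFunOnFinite.symm f) 1 := by
  rw [MvPolynomial.monomial_eq, Finsupp.prod_fintype _ _ (by simp)]
  simp

theorem card_colorings_of_content (M : κ → ℕ) (hM : ∑ t, M t = Fintype.card α) :
    #{f : α → κ | ∀ t, #{k | f k = t} = M t} = Nat.multinomial univ M := by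
  have h := Finset.sum_pow_eq_sum_piAntidiag (univ : Finset κ)
    (fun t => (MvPolynomial.X t : MvPolynomial κ ℕ)) (Fintype.card α)
  rw [← Finset.card_univ (α := α), ← Finset.prod_const, Finset.prod_univ_sum] at h
  have key (f : α → κ) : ∏ k, (MvPolynomial.X (f k) : MvPolynomial κ ℕ)
      = MvPolynomial.monomial (Finsupp.equivFunOnFinite.symm fun t => #{k | f k = t}) 1 := by
    rw [← prod_X_pow_eq_monomial, ← Finset.prod_fiberwise' univ f]
    simp
  apply_fun MvPolynomial.coeff (Finsupp.equivFunOnFinite.symm M) at h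
  simp only [key, prod_X_pow_eq_monomial, MvPolynomial.coeff_sum, MvPolynomial.coeff_monomial,
    ← MvPolynomial.C_eq_coe_nat, MvPolynomial.coeff_C_mul, Equiv.apply_eq_iff_eq] at h
  rw [Finset.sum_eq_single M (by simp +contextual) (by simp [hM]), Fintype.piFinset_univ,
    Finset.sum_boole] at h
  simpa [funext_iff] using h

/-- The average of the power sums of all permutations is the complete homogeneous polynomial. -/
theorem sum_coloringSum (z : κ → R) :
    ∑ g : Perm α, coloringSum z g = (Fintype.card α).factorial *
      ∑ M ∈ piAntidiag univ (Fintype.card α), ∏ t : κ, z t ^ M t := by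
  have stab (f : α → κ) : #{g : Perm α | f ∘ g = f} = ∏ t, (#{k | f k = t}).factorial := by
    have := DomMulAct.stabilizer_card f
    rw [Fintype.card_subtype] at this
    simpa [Fintype.card_subtype] using this
  simp only [coloringSum, Finset.sum_filter]
  rw [Finset.sum_comm]
  simp only [← Finset.sum_filter, Finset.sum_const, stab]
  rw [← Finset.sum_fiberwise_of_maps_to (g := fun f t => #{k | f k = t})
    (t := piAntidiag univ (Fintype.card α))]
  · rw [Finset.mul_sum]
    refine Finset.sum_congr rfl fun M hM => ?_
    have hM' : ∑ t, M t = Fintype.card α := by simpa using hM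
    rw [Finset.sum_congr rfl (g := fun _ => (∏ t, (M t).factorial) • ∏ t, z t ^ M t),
      Finset.sum_const]
    · have : #{f : α → κ | (fun t => #{k | f k = t}) = M} = Nat.multinomial univ M := by
        rw [← card_colorings_of_content M hM']
        simp [funext_iff]
      rw [this, ← hM', ← Nat.multinomial_spec, nsmul_eq_mul, nsmul_eq_mul]
      push_cast
      ring
    · intro f hf
      simp only [mem_filter, mem_univ, true_and] at hf
      rw [← Finset.prod_fiberwise' univ f, ← hf]
      simp
  · intro f _
    simp only [mem_piAntidiag, mem_univ, implies_true, and_true]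
    rw [← Finset.card_eq_sum_card_fiberwise (by simp), Finset.card_univ]

/-- `coloringSum` is the product of the power sums indexed by the lengths of the cycles of `g`. -/
theorem coloringSum_eq_prod (z : κ → R) (g : Perm α) [DecidableRel g.SameCycle] :
    coloringSum z g = ∏ q : Quotient (Perm.SameCycle.setoid g),
      ∑ t, z t ^ #{k | Quotient.mk (Perm.SameCycle.setoid g) k = q} := by
  rw [Finset.prod_univ_sum, coloringSum, Fintype.piFinset_univ]
  refine (Finset.sum_nbij (fun F k => F (Quotient.mk _ k)) ?_ ?_ ?_ ?_).symm
  · intro F _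
    simp only [mem_filter, mem_univ, true_and]
    ext k
    exact congrArg F (Quotient.sound ((Perm.sameCycle_apply_left).2 (Perm.SameCycle.refl g k)))
  · intro F _ F' _ h
    ext q
    induction q using Quotient.inductionOn with
    | h k => exact congrFun h k
  · intro f hf
    simp only [coe_filter, mem_univ, true_and, Set.mem_ofPred_eq] at hf
    refine ⟨Quotient.lift f ?_, by simp, ?_⟩
    · rintro k l ⟨i, rfl⟩
      have hz : ∀ (i : ℤ) k, f ((g ^ i) k) = f k := by
        have h1 : ∀ k, f (g k) = f k := fun k => congrFun hf k
        have h2 : ∀ k, f (g⁻¹ k) = f k := fun k => by rw [← h1 (g⁻¹ k)]; simp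
        intro i
        induction i using Int.induction_on with
        | zero => simp
        | succ i ih => intro k; rw [zpow_add_one, Perm.mul_apply, ih, h1]
        | pred i ih => intro k; rw [zpow_sub_one, Perm.mul_apply, ih, h2]
      exact (hz i k).symm
    · rfl
  · intro F _
    rw [← Finset.prod_fiberwise' univ (fun k => Quotient.mk (Perm.SameCycle.setoid g) k)
      (fun q => z (F q))]
    simp

end Coloring

/-- The set of irreducible complex characters of a group, as functions. -/
def irrChar (G : Type) [Group G] : Set (G → ℂ) :=
  {χ | ∃ V : FDRep ℂ G, Simple V ∧ V.character = χ}

section Characters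

variable {G : Type} [Group G] [Fintype G]

theorem character_mem_irrChar {V : Type} [AddCommGroup V] [Module ℂ V] [FiniteDimensional ℂ V]
    (ρ : Representation ℂ G V) [ρ.IsIrreducible] : ρ.character ∈ irrChar G := by
  have := invertibleOfNonzero (NeZero.ne (Nat.card G : ℂ))
  refine ⟨FDRep.of ρ, ?_, rfl⟩
  rw [FDRep.simple_iff_char_is_norm_one]
  have h := Representation.char_orthonormal ρ ρ
  rw [if_pos ⟨Representation.Equiv.refl ρ⟩] at h
  rwa [inv_mul_eq_one₀ (NeZero.ne _), eq_comm] at h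

theorem character_mem_span {V : Type} [AddCommGroup V] [Module ℂ V] [FiniteDimensional ℂ V]
    (ρ : Representation ℂ G V) : ρ.character ∈ Submodule.span ℤ (irrChar G) := by
  induction hd : Module.finrank ℂ V using Nat.strong_induction_on generalizing V with
  | _ d ih =>
  by_cases hirr : ρ.IsIrreducible
  · exact Submodule.subset_span (character_mem_irrChar ρ)
  by_cases hV : Subsingleton V
  · have : ρ.character = 0 := by
      ext g
      have : ρ g = 0 := Subsingleton.elim _ _
      simp [Representation.character, this]
    rw [this]
    exact zero_mem _
  have hnt : Nontrivial (Subrepresentation ρ) := by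
    refine ⟨⊥, ⊤, fun h => hV ?_⟩
    have h' : (⊥ : Submodule ℂ V) = ⊤ := congrArg Subrepresentation.toSubmodule h
    exact (Submodule.subsingleton_iff ℂ).1 (subsingleton_of_bot_eq_top h')
  obtain ⟨S, hSb, hSt⟩ : ∃ S : Subrepresentation ρ, S ≠ ⊥ ∧ S ≠ ⊤ := by
    by_contra! hcon
    exact hirr ⟨fun S => or_iff_not_imp_left.2 (hcon S)⟩
  obtain ⟨T, hST⟩ := exists_isCompl S
  have hc : IsCompl S.toSubmodule T.toSubmodule := by
    constructor
    · rw [disjoint_iff]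
      exact congrArg Subrepresentation.toSubmodule (disjoint_iff.1 hST.1)
    · rw [codisjoint_iff]
      exact congrArg Subrepresentation.toSubmodule (codisjoint_iff.1 hST.2)
  have hchar : ρ.character = S.toRepresentation.character + T.toRepresentation.character := by
    ext g
    have : ρ g = (Submodule.prodEquivOfIsCompl _ _ hc).conj
        ((S.toRepresentation g).prodMap (T.toRepresentation g)) := by
      rw [LinearEquiv.conj_apply, LinearEquiv.eq_comp_toLinearMap_symm]
      refine LinearMap.ext fun v => ?_
      simp [Subrepresentation.toRepresentation]
    rw [Representation.character, this, LinearMap.trace_conj', LinearMap.trace_prodMap']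
    rfl
  have hfin := Submodule.finrank_add_eq_of_isCompl hc
  have pos {U : Subrepresentation ρ} (hU : U ≠ ⊥) : 0 < Module.finrank ℂ U.toSubmodule := by
    rw [Module.finrank_pos_iff, Submodule.nontrivial_iff_ne_bot]
    exact fun h => hU (Subrepresentation.toSubmodule_injective h)
  have hTb : T ≠ ⊥ := by
    rintro rfl
    exact hSt (by simpa using hST.sup_eq_top)
  have := pos hSb
  have := pos hTb
  rw [hchar]
  exact add_mem (ih _ (by omega) _ rfl) (ih _ (by omega) _ rfl)

theorem permutation_character_mem_span {X : Type} [Fintype X] [DecidableEq X] [MulAction G X] :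
    (fun g : G => (Finset.card {x : X | g • x = x} : ℂ)) ∈ Submodule.span ℤ (irrChar G) := by
  let ρ : Representation ℂ G (X → ℂ) :=
    { toFun g := LinearMap.funLeft ℂ ℂ (fun x => g⁻¹ • x)
      map_one' := by ext; simp
      map_mul' g h := by ext; simp [LinearMap.funLeft, mul_smul] }
  convert character_mem_span ρ using 1
  ext g
  rw [Representation.character, LinearMap.trace_eq_matrix_trace ℂ (Pi.basisFun ℂ X)]
  simp [ρ, Matrix.trace, LinearMap.funLeft_apply, Pi.single_apply, inv_smul_eq_iff,
    eq_comm (b := g • _)]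

/-- A virtual character of norm one is irreducible up to sign. -/
theorem exists_irreducible_of_norm_one {χ : G → ℂ} (hχ : χ ∈ Submodule.span ℤ (irrChar G))
    (hnorm : ∑ g, χ g * χ g⁻¹ = Nat.card G) : χ ∈ irrChar G ∨ -χ ∈ irrChar G := by
  have := invertibleOfNonzero (NeZero.ne (Nat.card G : ℂ))
  obtain ⟨c, hc⟩ := (Finsupp.mem_span_iff_linearCombination _ _ _).1 hχ
  have hc' : χ = ∑ s ∈ c.support, c s • (s : G → ℂ) := by
    rw [← hc, Finsupp.linearCombination_apply, Finsupp.sum]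
  have orth (s t : irrChar G) :
      ∑ g, (s : G → ℂ) g * (t : G → ℂ) g⁻¹ = if s = t then (Nat.card G : ℂ) else 0 := by
    classical
    obtain ⟨s, hs⟩ := s
    obtain ⟨t, ht⟩ := t
    simp only [Subtype.mk.injEq]
    obtain ⟨V, hV, rfl⟩ := hs
    obtain ⟨W, hW, rfl⟩ := ht
    have h := FDRep.char_orthonormal V W
    rw [inv_mul_eq_iff_eq_mul₀ (NeZero.ne _)] at h
    rw [h]
    by_cases hVW : Nonempty (V ≅ W)
    · rw [if_pos hVW, if_pos (FDRep.char_iso hVW.some), mul_one]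
    · rw [if_neg hVW, mul_zero, if_neg]
      intro heq
      have h2 := FDRep.char_orthonormal V V
      rw [if_pos ⟨Iso.refl V⟩, inv_mul_eq_iff_eq_mul₀ (NeZero.ne _)] at h2
      rw [← heq, if_neg hVW, h2] at h
      simp at h
  have hsq : ∑ s ∈ c.support, c s ^ 2 = 1 := by
    have : (∑ s ∈ c.support, (c s : ℂ) ^ 2) * Nat.card G = Nat.card G := by
      refine Eq.trans ?_ hnorm
      have expand (g : G) : χ g * χ g⁻¹ = ∑ s ∈ c.support, ∑ t ∈ c.support,
          c s * (c t : ℂ) * ((s : G → ℂ) g * (t : G → ℂ) g⁻¹) := by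
        simp only [hc', Finset.sum_apply, Pi.smul_apply, Finset.sum_mul_sum]
        simp only [zsmul_eq_mul, mul_mul_mul_comm]
      simp only [expand]
      rw [Finset.sum_comm, Finset.sum_mul]
      refine Finset.sum_congr rfl fun s hs => ?_
      rw [Finset.sum_comm]
      simp only [← Finset.mul_sum, orth]
      simp [Finsupp.mem_support_iff.1 hs, sq]
    have := mul_right_cancel₀ (NeZero.ne (Nat.card G : ℂ)) (this.trans (one_mul _).symm)
    exact_mod_cast this
  obtain ⟨s, hs⟩ : c.support.Nonempty := by
    by_contra! h
    simp [h] at hsq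
  have hcs : c s ≠ 0 := Finsupp.mem_support_iff.1 hs
  have hone : c.support = {s} ∧ c s ^ 2 = 1 := by
    have h1 : ∀ t ∈ c.support, 1 ≤ c t ^ 2 := fun t ht =>
      Int.add_one_le_iff.2 (sq_pos_of_ne_zero (Finsupp.mem_support_iff.1 ht))
    have hcard : (c.support.card : ℤ) ≤ 1 := by
      rw [← hsq]
      simpa using Finset.card_nsmul_le_sum c.support (fun t => c t ^ 2) 1 h1
    have hsupp : c.support = {s} :=
      Finset.eq_singleton_iff_unique_mem.2
        ⟨hs, fun t ht => Finset.card_le_one.1 (by exact_mod_cast hcard) t ht s hs⟩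
    refine ⟨hsupp, ?_⟩
    rwa [hsupp, Finset.sum_singleton] at hsq
  rw [hone.1, Finset.sum_singleton] at hc'
  rcases sq_eq_one_iff.1 hone.2 with h | h
  · left; rw [hc', h, one_smul]; exact s.2
  · right; rw [hc', h]; simp

end Characters

section AlternantPowerSum

open Finset Matrix MvPolynomial

variable {α : Type*} [Fintype α] [DecidableEq α] {h : ℕ}

theorem coloringSum_inv {κ R : Type*} [Fintype κ] [DecidableEq κ] [CommSemiring R] (z : κ → R)
    (g : Equiv.Perm α) : coloringSum z g⁻¹ = coloringSum z g := by
  rw [coloringSum, coloringSum]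
  congr 1
  ext f
  simp only [mem_filter, mem_univ, true_and]
  exact (Equiv.eq_comp_symm g f f).symm.trans eq_comm |>.trans (by rfl) |>.symm

/-- The product of the Vandermonde determinant with the power sum symmetric polynomial of the cycle
type of `g`. -/
noncomputable def alternantPowerSum (h : ℕ) (g : Equiv.Perm α) : MvPolynomial (Fin h) ℤ :=
  (vandermonde X).det * coloringSum X g

theorem coeff_coeff_prod {β : Fin h →₀ ℕ} (hβ : Function.Injective β) (σ : Equiv.Perm (Fin h))
    (m : Fin h → ℕ) :
    coeff β (coeff β (∏ i,
      (X (σ i) * C (X i) : MvPolynomial (Fin h) (MvPolynomial (Fin h) ℤ)) ^ m i)) =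
      if σ = 1 ∧ m = β then 1 else 0 := by
  simp only [mul_pow, Finset.prod_mul_distrib, ← map_pow, ← map_prod]
  rw [prod_X_pow_eq_monomial, ← Equiv.prod_comp σ.symm]
  simp only [Equiv.apply_symm_apply]
  rw [prod_X_pow_eq_monomial _ (fun i => m (σ.symm i)), mul_comm, coeff_C_mul, coeff_monomial,
    mul_ite, mul_one, mul_zero, apply_ite (coeff β), coeff_monomial, coeff_zero, ← ite_and]
  congr 1
  simp only [eq_iff_iff, DFunLike.ext_iff, funext_iff, Finsupp.equivFunOnFinite_symm_apply_apply]
  constructor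
  · rintro ⟨h1, h2⟩
    refine ⟨fun i => ?_, h2⟩
    have := h1 (σ i)
    rw [Equiv.symm_apply_apply, h2] at this
    exact (hβ this).symm
  · rintro ⟨h1, h2⟩
    obtain rfl : σ = 1 := Equiv.ext h1
    exact ⟨fun i => h2 i, h2⟩

/-- The coefficients of the alternants `alternantPowerSum` have norm one as class functions. -/
theorem sum_coeff_alternantPowerSum_sq {β : Fin h →₀ ℕ} (hβ : Function.Injective β)
    (hsum : ∑ i, β i = Fintype.card α + ∑ i : Fin h, (i : ℕ)) :
    ∑ g : Equiv.Perm α, coeff β (alternantPowerSum h g) * coeff β (alternantPowerSum h g⁻¹)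
      = (Fintype.card α).factorial := by
  have key := cauchy_identity (fun i => (X i : MvPolynomial (Fin h) (MvPolynomial (Fin h) ℤ)))
    (fun i => C (X i)) (Fintype.card α)
  have hx (g : Equiv.Perm α) : map C (alternantPowerSum h g) =
      (vandermonde fun i => (X i : MvPolynomial (Fin h) (MvPolynomial (Fin h) ℤ))).det *
        coloringSum X g := by
    rw [alternantPowerSum, map_mul, map_coloringSum, RingHom.map_det]
    congr 2
    · ext1 i j; simp [vandermonde_apply]
    · simp
  have hy (g : Equiv.Perm α) : C (alternantPowerSum h g) =
      (vandermonde fun i => (C (X i) : MvPolynomial (Fin h) (MvPolynomial (Fin h) ℤ))).det *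
        coloringSum (fun i => C (X i)) g := by
    rw [alternantPowerSum, map_mul, map_coloringSum, RingHom.map_det]
    congr 2
    ext1 i j; simp [vandermonde_apply]
  have key' : ∑ g : Equiv.Perm α, C (alternantPowerSum h g) * map C (alternantPowerSum h g) =
      C (C ((Fintype.card α).factorial : ℤ)) * ∑ σ : Equiv.Perm (Fin h), Equiv.Perm.sign σ •
      ∑ m ∈ piAntidiag univ (Fintype.card α + ∑ i : Fin h, (i : ℕ)), ∏ i, (X (σ i) * C (X i) :
        MvPolynomial (Fin h) (MvPolynomial (Fin h) ℤ)) ^ m i := by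
    rw [← key, mul_left_comm]
    have := sum_coloringSum (α := α) (fun t : Fin h × Fin h =>
      (X t.1 * C (X t.2) : MvPolynomial (Fin h) (MvPolynomial (Fin h) ℤ)))
    simp only [coloringSum_mul X (fun j => C (X j))] at this
    rw [map_natCast, map_natCast, ← this, Finset.mul_sum]
    refine Finset.sum_congr rfl fun g _ => ?_
    rw [hx, hy]
    ring
  apply_fun (fun p => coeff β (coeff β p)) at key'
  simp only [coeff_C_mul, coeff_map, coeff_sum, Units.smul_def, coeff_smul,
    coeff_coeff_prod hβ] at key'
  have hdiag : ∑ σ : Equiv.Perm (Fin h), (Equiv.Perm.sign σ : ℤ) •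
      ∑ m ∈ piAntidiag univ (Fintype.card α + ∑ i : Fin h, (i : ℕ)),
        (if σ = 1 ∧ m = β then 1 else 0 : ℤ) = 1 := by
    rw [Finset.sum_eq_single 1 (by simp +contextual) (by simp),
      Finset.sum_eq_single ⇑β (by simp +contextual) (by simp [hsum])]
    simp
  rw [hdiag] at key'
  have hC (p : MvPolynomial (Fin h) ℤ) (c : ℤ) : coeff β (p * C c) = coeff β p * c := by
    rw [mul_comm, coeff_C_mul, mul_comm]
  simp only [hC, alternantPowerSum, coloringSum_inv] at key' ⊢
  simpa using key'

theorem coeff_coloringSum {κ : Type*} [Fintype κ] [DecidableEq κ] (γ : κ →₀ ℕ)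
    (g : Equiv.Perm α) :
    coeff γ (coloringSum X g : MvPolynomial κ ℤ) =
      #{f : α → κ | f ∘ g = f ∧ ∀ t, #{k | f k = t} = γ t} := by
  have key (f : α → κ) : ∏ k, (X (f k) : MvPolynomial κ ℤ)
      = monomial (Finsupp.equivFunOnFinite.symm fun t => #{k | f k = t}) 1 := by
    rw [← prod_X_pow_eq_monomial, ← Finset.prod_fiberwise' univ f]
    simp
  simp only [coloringSum, key, coeff_sum, coeff_monomial, Finset.sum_boole, Finset.filter_filter]
  simp [DFunLike.ext_iff]

theorem coeff_coloringSum_mem_span {n : ℕ} {κ : Type} [Fintype κ] [DecidableEq κ] (γ : κ →₀ ℕ) :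
    (fun g : Equiv.Perm (Fin n) => ((coeff γ (coloringSum X g : MvPolynomial κ ℤ) : ℤ) : ℂ)) ∈
      Submodule.span ℤ (irrChar (Equiv.Perm (Fin n))) := by
  let _ : MulAction (Equiv.Perm (Fin n)) {f : Fin n → κ // ∀ t, #{k | f k = t} = γ t} :=
    { smul g f := ⟨f.1 ∘ g.symm, fun t => by
        rw [← f.2 t]
        exact Finset.card_equiv g.symm (by simp)⟩
      one_smul f := rfl
      mul_smul g g' f := rfl }
  convert permutation_character_mem_span (G := Equiv.Perm (Fin n))
    (X := {f : Fin n → κ // ∀ t, #{k | f k = t} = γ t}) with g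
  rw [coeff_coloringSum, Int.cast_natCast, Nat.cast_inj]
  refine (Finset.card_bij (fun f _ => f.1) ?_ (fun _ _ _ _ => Subtype.ext) ?_).symm
  · intro f hf
    have hf' : f.1 ∘ g.symm = f.1 := congrArg Subtype.val (mem_filter.1 hf).2
    simpa [f.2] using ((Equiv.comp_symm_eq g f.1 f.1).1 hf').symm
  · intro f hf
    obtain ⟨-, h1, h2⟩ := mem_filter.1 hf
    exact ⟨⟨f, h2⟩, by
      simpa using Subtype.ext ((Equiv.comp_symm_eq g f f).2 h1.symm), rfl⟩

/-- The coefficients of `alternantPowerSum` are virtual characters of the symmetric group. -/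
theorem coeff_alternantPowerSum_mem_span {n : ℕ} (β : Fin h →₀ ℕ) :
    (fun g : Equiv.Perm (Fin n) => ((coeff β (alternantPowerSum h g) : ℤ) : ℂ)) ∈
      Submodule.span ℤ (irrChar (Equiv.Perm (Fin n))) := by
  let δ (σ : Equiv.Perm (Fin h)) : Fin h →₀ ℕ :=
    Finsupp.equivFunOnFinite.symm fun i => ((σ.symm i : Fin h) : ℕ)
  have (g : Equiv.Perm (Fin n)) : coeff β (alternantPowerSum h g) =
      ∑ σ : Equiv.Perm (Fin h), (Equiv.Perm.sign σ : ℤ) *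
        if δ σ ≤ β then
          coeff (β - δ σ) (coloringSum X g)
        else 0 := by
    rw [alternantPowerSum, det_apply, Finset.sum_mul, coeff_sum]
    refine Finset.sum_congr rfl fun σ _ => ?_
    rw [← Equiv.prod_comp σ.symm]
    simp only [vandermonde_apply, Equiv.apply_symm_apply]
    rw [prod_X_pow_eq_monomial _ (fun i => ((σ.symm i : Fin h) : ℕ)), Units.smul_def,
      smul_mul_assoc, coeff_smul, coeff_monomial_mul', smul_eq_mul, one_mul]
  have h2 : (fun g : Equiv.Perm (Fin n) => ((coeff β (alternantPowerSum h g) : ℤ) : ℂ)) =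
      ∑ σ : Equiv.Perm (Fin h), (Equiv.Perm.sign σ : ℤ) •
        if δ σ ≤ β then
          (fun g : Equiv.Perm (Fin n) => ((coeff (β - δ σ) (coloringSum X g) : ℤ) : ℂ)) else 0 := by
    ext g
    rw [this, Finset.sum_apply]
    push_cast
    refine Finset.sum_congr rfl fun σ _ => ?_
    split_ifs <;> simp
  rw [h2]
  refine sum_mem fun σ _ => Submodule.smul_mem _ _ ?_
  split_ifs
  · exact coeff_coloringSum_mem_span _
  · exact zero_mem _

end AlternantPowerSum

section Vanishing

open Finset Matrix MvPolynomial

variable {h : ℕ}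

theorem sum_le_sum_of_card_eq_of_sdiff_le {A B : Finset ℕ} (hAB : #A = #B)
    (hle : ∀ x ∈ B \ A, ∀ y ∈ A \ B, y ≤ x) : ∑ y ∈ A, y ≤ ∑ x ∈ B, x := by
  rw [← sum_inter_add_sum_sdiff A B, ← sum_inter_add_sum_sdiff B A, inter_comm]
  have hcard := card_sdiff_comm hAB
  refine Nat.add_le_add_left ?_ _
  rcases (B \ A).eq_empty_or_nonempty with hBA | hBA
  · rw [hBA, card_empty, card_eq_zero] at hcard
    rw [hcard]
    simp
  · calc ∑ y ∈ A \ B, y ≤ #(A \ B) • (B \ A).min' hBA :=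
          sum_le_card_nsmul _ _ _ fun y hy => hle _ (min'_mem _ _) y hy
      _ = #(B \ A) • (B \ A).min' hBA := by rw [hcard]
      _ ≤ ∑ x ∈ B \ A, x := card_nsmul_le_sum _ _ _ fun x hx => min'_le _ x hx

/-- The beta-set of an `r`-core has the smallest sum among all sets of natural numbers with the same
number of elements in each residue class modulo `r`. -/
theorem sum_le_sum_of_modEq {ι : Type*} [Fintype ι] {r : ℕ} {b γ : ι → ℕ}
    (hb : Function.Injective b) (hclosed : ∀ i, r ≤ b i → ∃ j, b j + r = b i)
    (hγ : Function.Injective γ) (hmod : ∀ i, γ i ≡ b i [MOD r]) : ∑ i, b i ≤ ∑ i, γ i := by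
  have hrange (x k : ℕ) : x + k * r ∈ Set.range b → x ∈ Set.range b := by
    induction k with
    | zero => simp
    | succ k ih =>
      rintro ⟨i, hi⟩
      obtain ⟨j, hj⟩ := hclosed i (by rw [hi]; nlinarith)
      exact ih ⟨j, by rw [hi] at hj; linarith⟩
  rw [← sum_fiberwise_of_maps_to (fun i _ => mem_image_of_mem (fun i => b i % r) (mem_univ i)) b,
    ← sum_fiberwise_of_maps_to (fun i _ => mem_image_of_mem (fun i => b i % r) (mem_univ i)) γ]
  refine Finset.sum_le_sum fun c _ => ?_
  rw [← sum_image (f := fun x : ℕ => x) hb.injOn, ← sum_image (f := fun x : ℕ => x) hγ.injOn]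
  refine sum_le_sum_of_card_eq_of_sdiff_le ?_ fun x hx y hy => ?_
  · rw [card_image_of_injective _ hb, card_image_of_injective _ hγ]
  · by_contra! hxy
    simp only [mem_sdiff, mem_image, mem_filter, mem_univ, true_and] at hx hy
    obtain ⟨⟨i, hi, rfl⟩, hx⟩ := hx
    obtain ⟨⟨j, hj, rfl⟩, -⟩ := hy
    obtain ⟨k, hk⟩ := (Nat.modEq_iff_dvd' hxy.le).1 ((hmod i).trans (hi.trans hj.symm))
    obtain ⟨l, hl⟩ := hrange (γ i) k ⟨j, by rw [mul_comm, ← hk]; omega⟩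
    exact hx ⟨l, by rw [hl, ← hi]; exact hmod i, hl⟩

/-- An alternating polynomial has no monomials with a repeated exponent. -/
theorem coeff_vandermonde_mul_eq_zero {Q : MvPolynomial (Fin h) ℤ} (hQ : Q.IsSymmetric)
    {γ : Fin h →₀ ℕ} (hγ : ¬ Function.Injective γ) :
    coeff γ ((vandermonde X).det * Q) = 0 := by
  simp only [Function.Injective, not_forall] at hγ
  obtain ⟨i, j, hij, hne⟩ := hγ
  have hV : rename (Equiv.swap i j) ((vandermonde X).det : MvPolynomial (Fin h) ℤ) =
      -(vandermonde X).det := by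
    rw [AlgHom.map_det]
    have : (rename (Equiv.swap i j)).mapMatrix (vandermonde X : Matrix _ _ (MvPolynomial (Fin h) ℤ))
        = (vandermonde X).submatrix (Equiv.swap i j) id := by
      ext1 k l
      simp [vandermonde_apply]
    rw [this, det_permute, Equiv.Perm.sign_swap hne]
    simp
  have hfix : Finsupp.mapDomain (Equiv.swap i j) γ = γ := by
    ext k
    rw [← Finsupp.equivMapDomain_eq_mapDomain, Finsupp.equivMapDomain_apply, Equiv.symm_swap]
    rcases eq_or_ne k i with rfl | hki
    · simp [hij]
    rcases eq_or_ne k j with rfl | hkj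
    · simp [hij]
    · rw [Equiv.swap_apply_of_ne_of_ne hki hkj]
  have := coeff_rename_mapDomain _ (Equiv.swap i j).injective ((vandermonde X).det * Q) γ
  rw [hfix, map_mul, hV, hQ, neg_mul, coeff_neg] at this
  linarith

theorem coeff_mul_psum_pow_eq_zero {F : MvPolynomial (Fin h) ℤ}
    (hF : ∀ γ : Fin h →₀ ℕ, ¬ Function.Injective γ → coeff γ F = 0) {r : ℕ} {b : Fin h → ℕ}
    (hb : Function.Injective b) (hclosed : ∀ i, r ≤ b i → ∃ j, b j + r = b i) (s : ℕ)
    (β : Fin h →₀ ℕ) (hmod : ∀ i, β i ≡ b i [MOD r]) (hsum : ∑ i, β i < ∑ i, b i + s * r) :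
    coeff β (F * psum (Fin h) ℤ r ^ s) = 0 := by
  induction s generalizing β with
  | zero =>
    rw [pow_zero, mul_one]
    refine hF β fun hβ => ?_
    have := sum_le_sum_of_modEq hb hclosed hβ hmod
    omega
  | succ s ih =>
    rw [pow_succ, ← mul_assoc, psum, Finset.mul_sum, coeff_sum]
    refine Finset.sum_eq_zero fun i _ => ?_
    rw [X_pow_eq_monomial, coeff_mul_monomial', mul_one]
    split_ifs with hi
    · obtain ⟨γ, rfl⟩ := exists_add_of_le hi
      rw [add_tsub_cancel_left]
      refine ih γ (fun j => ?_) ?_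
      · refine Nat.ModEq.trans ?_ (hmod j)
        rw [Finsupp.add_apply, Finsupp.single_apply]
        split_ifs
        · exact (Nat.add_modEq_left).symm
        · rw [zero_add]
      · simp only [Finsupp.add_apply, Finset.sum_add_distrib, Finsupp.single_apply,
          Finset.sum_ite_eq, Finset.mem_univ, if_true] at hsum
        rw [add_mul] at hsum
        omega
    · rfl

end Vanishing

section PowerSumFactor

open Finset MvPolynomial

variable {α : Type*} [Fintype α] [DecidableEq α] {κ : Type*} [Fintype κ] [DecidableEq κ]

theorem card_cycleFactorsFinset_le_card_quotient (g : Equiv.Perm α) [DecidableRel g.SameCycle]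
    (r : ℕ) : #{c ∈ g.cycleFactorsFinset | #c.support = r} ≤
      #{q : Quotient (Equiv.Perm.SameCycle.setoid g) |
        #{k | Quotient.mk (Equiv.Perm.SameCycle.setoid g) k = q} = r} := by
  refine Finset.card_le_card_of_surjOn (fun q => g.cycleOf q.out) fun c hc => ?_
  obtain ⟨hcg, rfl⟩ := mem_filter.1 hc
  obtain ⟨x, hx⟩ := (Equiv.Perm.mem_cycleFactorsFinset_iff.1 hcg).1.nonempty_support
  obtain rfl := Equiv.Perm.cycle_is_cycleOf hx hcg
  refine ⟨Quotient.mk _ x, ?_, ?_⟩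
  · simp only [coe_filter, mem_univ, true_and, Set.mem_ofPred_eq]
    congr 1
    ext k
    rw [mem_filter, Equiv.Perm.mem_support_cycleOf_iff, Quotient.eq]
    refine ⟨fun h => ⟨h.2.symm, ?_⟩, fun h => ⟨mem_univ _, h.1.symm⟩⟩
    exact Equiv.Perm.mem_cycleFactorsFinset_support_le hcg hx
  · convert (Quotient.mk_out (s := Equiv.Perm.SameCycle.setoid g) x).cycleOf_eq

theorem exists_coloringSum_eq_mul_psum_pow (g : Equiv.Perm α) {r s : ℕ}
    (hs : s ≤ #{c ∈ g.cycleFactorsFinset | #c.support = r}) :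
    ∃ Q : MvPolynomial κ ℤ, Q.IsSymmetric ∧ coloringSum X g = Q * psum κ ℤ r ^ s := by
  have : DecidableRel g.SameCycle := inferInstance
  obtain ⟨T, hT, hTs⟩ := exists_subset_card_eq
    (hs.trans (card_cycleFactorsFinset_le_card_quotient g r))
  refine ⟨∏ q ∈ Tᶜ, psum κ ℤ #{k | Quotient.mk (Equiv.Perm.SameCycle.setoid g) k = q},
    fun e => ?_, ?_⟩
  · rw [map_prod]
    exact Finset.prod_congr rfl fun q _ => psum_isSymmetric κ ℤ _ e
  · rw [coloringSum_eq_prod, ← Finset.prod_compl_mul_prod T, ← hTs]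
    congr 1
    refine Finset.prod_eq_pow_card fun q hq => ?_
    rw [(mem_filter.1 (hT hq)).2, psum]

end PowerSumFactor

section BetaNumber

open Finset

/-- The beta-numbers of a Young diagram, read off its first `h` rows. -/
def betaNumber (Y : YoungDiagram) (h : ℕ) (i : Fin h) : ℕ := Y.rowLen i + (h - 1 - i)

theorem betaNumber_strictAnti (Y : YoungDiagram) (h : ℕ) : StrictAnti (betaNumber Y h) := by
  intro i j hij
  have := Y.rowLen_anti i j hij.le
  have : (i : ℕ) < j := hij
  have := j.2
  simp only [betaNumber]
  omega

theorem sum_betaNumber (Y : YoungDiagram) {h : ℕ} (hY : Y.colLen 0 ≤ h) :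
    ∑ i, betaNumber Y h i = Y.cells.card + ∑ i : Fin h, (i : ℕ) := by
  simp only [betaNumber, sum_add_distrib]
  congr 1
  · rw [Fin.sum_univ_eq_sum_range (fun i => Y.rowLen i), card_eq_sum_card_fiberwise (f := Prod.fst)
      (t := range h)]
    · exact Finset.sum_congr rfl fun i _ => Y.rowLen_eq_card
    · rintro ⟨i, j⟩ hij
      rw [mem_coe, mem_range]
      have : (i, 0) ∈ Y := Y.up_left_mem le_rfl (Nat.zero_le j) hij
      exact (YoungDiagram.mem_iff_lt_colLen.1 this).trans_le hY
  · rw [← Equiv.sum_comp Fin.revPerm]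
    exact Finset.sum_congr rfl fun i _ => by simp [Fin.val_rev]; omega

/-- The beta-set of an `r`-core is stable under subtracting `r`. -/
theorem IsRCore.exists_betaNumber_add_eq {r : ℕ} {Y : YoungDiagram} (hcore : IsRCore r Y) {h : ℕ}
    (hY : Y.colLen 0 ≤ h) (i : Fin h) (hi : r ≤ betaNumber Y h i) :
    ∃ j, betaNumber Y h j + r = betaNumber Y h i := by
  by_contra! hne
  rcases r.eq_zero_or_pos with rfl | hr
  · exact hne i rfl
  obtain ⟨c, hc⟩ : ∃ c, betaNumber Y h i = c + r := Nat.exists_eq_add_of_le' hi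
  have hne' (k : Fin h) : betaNumber Y h k ≠ c := fun hk => hne k (by rw [hk, hc])
  have hex : ∃ m : ℕ, ∀ k : Fin h, m ≤ k → betaNumber Y h k < c := ⟨h, fun k hk => by omega⟩
  classical
  obtain ⟨m, hm, hmin⟩ : ∃ m : ℕ, (∀ k : Fin h, m ≤ k → betaNumber Y h k < c) ∧
      ∀ l < m, ∃ k : Fin h, l ≤ k ∧ c < betaNumber Y h k :=
    ⟨Nat.find hex, Nat.find_spec hex, fun l hl => by
      have := Nat.find_min hex hl
      push Not at this
      obtain ⟨k, hlk, hk⟩ := this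
      exact ⟨k, hlk, hk.lt_of_ne (hne' k).symm⟩⟩
  have him : (i : ℕ) < m := by
    by_contra! him
    have := hm i him
    omega
  obtain ⟨k, hk, hck⟩ := hmin (m - 1) (by omega)
  have hkm : (k : ℕ) < m := by
    by_contra! hkm
    exact (hm k hkm).not_gt hck
  have hrow : Y.rowLen m < c + m + 1 - h ∧ h ≤ c + m := by
    rcases lt_or_ge m h with hmh | hmh
    · have := hm ⟨m, hmh⟩ le_rfl
      simp only [betaNumber] at this
      omega
    · have : Y.rowLen m = 0 := by
        by_contra! h0
        have := YoungDiagram.mem_iff_lt_colLen.1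
          (YoungDiagram.mem_iff_lt_rowLen.2 (Nat.pos_of_ne_zero h0))
        omega
      omega
  obtain ⟨j, hj⟩ : ∃ j, c + m = j + h := Nat.exists_eq_add_of_le' hrow.2
  have hkj : ((k : ℕ), j) ∈ Y := YoungDiagram.mem_iff_lt_rowLen.2 (by
    simp only [betaNumber] at hck
    have := k.2
    omega)
  have hmj : (m, j) ∉ Y := fun hmem => by
    have := YoungDiagram.mem_iff_lt_rowLen.1 hmem
    omega
  have hcol : Y.colLen j = m := by
    have h1 := YoungDiagram.mem_iff_lt_colLen.1 hkj
    have h2 := mt YoungDiagram.mem_iff_lt_colLen.2 hmj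
    omega
  have hij : ((i : ℕ), j) ∈ Y := YoungDiagram.mem_iff_lt_colLen.2 (by omega)
  refine hcore (i, j) hij ⟨1, ?_⟩
  have := YoungDiagram.mem_iff_lt_rowLen.1 hij
  simp only [betaNumber] at hc
  simp only [hookLength, hcol]
  omega

end BetaNumber

theorem stmt13 (n : ℕ) (g : Equiv.Perm (Fin n)) (r a : ℕ) (hr : 1 ≤ r)
    (Y : YoungDiagram) (hcard : Y.cells.card + a * r = n) (hcore : IsRCore r Y)
    (hcyc : a < (g.cycleFactorsFinset.filter (fun c => c.support.card = r)).card) :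
    IsVanishing g := by
  let b := betaNumber Y (Y.colLen 0 + 1)
  have hb : StrictAnti b := betaNumber_strictAnti Y _
  let β : Fin (Y.colLen 0 + 1) →₀ ℕ :=
    Finsupp.equivFunOnFinite.symm b + Finsupp.single 0 (a * r)
  have hβ (i) : β i = b i + if i = 0 then a * r else 0 := by
    simp only [β, Finsupp.add_apply, Finsupp.single_apply, eq_comm (a := i)]
    rfl
  have hβ' : StrictAnti β := by
    intro i j hij
    have := hb hij
    rw [hβ, hβ, if_neg (Fin.ne_zero_of_lt hij)]
    omega
  have hβb : ∑ i, β i = ∑ i, b i + a * r := by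
    simp [hβ, Finset.sum_add_distrib]
  have hsum : ∑ i, β i = n + ∑ i : Fin (Y.colLen 0 + 1), (i : ℕ) := by
    rw [hβb, sum_betaNumber Y (Nat.le_succ _), ← hcard]
    ring
  have hzero : MvPolynomial.coeff β (alternantPowerSum (Y.colLen 0 + 1) g) = 0 := by
    obtain ⟨Q, hQ, hgQ⟩ := exists_coloringSum_eq_mul_psum_pow (κ := Fin (Y.colLen 0 + 1)) g
      (Nat.succ_le_of_lt hcyc)
    rw [alternantPowerSum, hgQ, ← mul_assoc]
    refine coeff_mul_psum_pow_eq_zero (fun γ => coeff_vandermonde_mul_eq_zero hQ) hb.injective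
      (hcore.exists_betaNumber_add_eq (Nat.le_succ _)) _ β (fun i => ?_) ?_
    · rw [hβ]
      split_ifs
      · simp [Nat.ModEq, b]
      · rfl
    · rw [hβb]
      gcongr
      exact Nat.lt_succ_self a
  have hnorm := sum_coeff_alternantPowerSum_sq (α := Fin n) hβ'.injective
    (by rw [hsum, Fintype.card_fin])
  have hχ := exists_irreducible_of_norm_one (coeff_alternantPowerSum_mem_span (n := n) β) (by
    rw [Nat.card_perm, Nat.card_eq_fintype_card]
    exact_mod_cast hnorm)
  obtain ⟨V, hV, hVχ⟩ | ⟨V, hV, hVχ⟩ := hχ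
  · exact ⟨V, hV, by simp [hVχ, hzero]⟩
  · exact ⟨V, hV, by simp [hVχ, hzero]⟩
end
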